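/- arXiv:2208.14680 — 2 statements merged into one kernel-verified Lean document; each statement's English description precedes it below -/
import Mathlib

section
/- Let k be an algebraically closed field of characteristic p > 0, let G be a normal subgroup of a finite group G̃, and let M be a support τ-tilting kG-module satisfying xM ≅ M as kG-modules for every x ∈ G̃. Then the induced module Ind_G^{G̃} M is a support τ-tilting kG̃-module. -/
/-!
Common definitions: τ-tilting theory over a ring, blocks of group algebras,
conjugate modules and induced modules.

Since group algebras (and their blocks) are symmetric algebras, the
Auslander–Reiten translate is `τ = Ω²` computed via (minimal) projective covers;
τ-rigidity is formulated accordingly.  Support τ-tilting modules are formulated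
via support τ-tilting pairs: `M` is support τ-tilting iff `M` is τ-rigid and
there is a projective module `P` with `Hom(P, M) = 0` and `|M| + |P| = |Λ|`
(the number of simple modules), which is the standard equivalent
characterisation (Adachi–Iyama–Reiten, Prop. 2.3; Remark 2.2 of the paper).
-/

universe u

section GeneralDefs

variable (A : Type u) [Ring A]

/-- A module is indecomposable if it is nontrivial and has no nontrivial
direct sum decomposition. -/
def IsIndecModule (X : Type u) [AddCommGroup X] [Module A X] : Prop :=
  Nontrivial X ∧ ∀ U V : Submodule A X, IsCompl U V → U = ⊥ ∨ V = ⊥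

/-- `|M|`: the number of isomorphism classes of indecomposable direct summands
of `M`. -/
noncomputable def numIndec (M : Type u) [AddCommGroup M] [Module A M] : ℕ :=
  Nat.card (Quot fun
    (L L' : {L : Submodule A M // (∃ L'', IsCompl L L'') ∧ IsIndecModule A L}) =>
      Nonempty (L.1 ≃ₗ[A] L'.1))

/-- `|A|`: the number of isomorphism classes of simple `A`-modules. -/
noncomputable def numSimples : ℕ :=
  Nat.card (Quot fun (X Y : {X : ModuleCat.{u} A // IsSimpleModule A X}) =>
    Nonempty ((X.1 : Type u) ≃ₗ[A] (Y.1 : Type u)))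

/-- The number of isomorphism classes of simple `A`-modules lying in the block
with block idempotent `b` (i.e. on which `b` acts as the identity). -/
noncomputable def numSimplesIn (b : A) : ℕ :=
  Nat.card (Quot fun
    (X Y : {X : ModuleCat.{u} A //
        IsSimpleModule A X ∧ ∀ v : (X : Type u), b • v = v}) =>
      Nonempty ((X.1 : Type u) ≃ₗ[A] (Y.1 : Type u)))

/-- `π : P → M` is a projective cover: `P` is projective, `π` is surjective and
`ker π` is superfluous (i.e. `π` is an essential epimorphism). -/
def IsProjCover {P M : Type u} [AddCommGroup P] [Module A P]
    [AddCommGroup M] [Module A M] (π : P →ₗ[A] M) : Prop :=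
  Module.Projective A P ∧ Function.Surjective π ∧
    ∀ N : Submodule A P, N ⊔ LinearMap.ker π = ⊤ → N = ⊤

/-- `M` is τ-rigid: `Hom(M, τ M) = 0`, where for the symmetric algebras
considered here `τ M = Ω² M` is computed from minimal projective presentations:
for (any) projective cover `π₀ : P₀ → M` and projective cover
`π₁ : P₁ → ker π₀`, one has `τ M = ker π₁`. -/
def IsTauRigid (M : Type u) [AddCommGroup M] [Module A M] : Prop :=
  ∀ (P₀ : Type u) [AddCommGroup P₀] [Module A P₀] (π₀ : P₀ →ₗ[A] M),
    IsProjCover A π₀ →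
    ∀ (P₁ : Type u) [AddCommGroup P₁] [Module A P₁]
      (π₁ : P₁ →ₗ[A] ↥(LinearMap.ker π₀)),
      IsProjCover A π₁ →
      ∀ g : M →ₗ[A] ↥(LinearMap.ker π₁), g = 0

/-- `M` is a support τ-tilting `A`-module (via support τ-tilting pairs):
`M` is τ-rigid and there is a (finitely generated) projective `A`-module `P`
with `Hom_A(P, M) = 0` and `|M| + |P| = |A|`. -/
def IsSupportTauTilting (M : Type u) [AddCommGroup M] [Module A M] : Prop :=
  IsTauRigid A M ∧
  ∃ P : ModuleCat.{u} A, Module.Projective A P ∧ Module.Finite A P ∧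
    (∀ f : (P : Type u) →ₗ[A] M, f = 0) ∧
    numIndec A M + numIndec A (P : Type u) = numSimples A

/-- `b` is a block idempotent: a primitive central idempotent of `A`.
The corresponding block is `B = A * b`. -/
def IsBlockIdem (b : A) : Prop :=
  b ≠ 0 ∧ b * b = b ∧ (∀ r : A, b * r = r * b) ∧
  ∀ c : A, c * c = c → (∀ r : A, c * r = r * c) → b * c = c → c = 0 ∨ c = b

/-- `M` is a support τ-tilting module over the block `B` with block idempotent
`b`: `M` lies in `B`, is τ-rigid (over `B`, equivalently over `A`) and there is
a projective module `P` lying in `B` with `Hom(P, M) = 0` and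
`|M| + |P| = |B|`. -/
def IsSupportTauTiltingBlock (b : A) (M : Type u) [AddCommGroup M]
    [Module A M] : Prop :=
  (∀ m : M, b • m = m) ∧ IsTauRigid A M ∧
  ∃ P : ModuleCat.{u} A, Module.Projective A P ∧ Module.Finite A P ∧
    (∀ v : (P : Type u), b • v = v) ∧
    (∀ f : (P : Type u) →ₗ[A] M, f = 0) ∧
    numIndec A M + numIndec A (P : Type u) = numSimplesIn A b

/-- The partial order on support τ-tilting modules: `M ≥ M'` iff there are
`r > 0` and an epimorphism `M^{⊕ r} ↠ M'`. -/
def stGE (M M' : Type u) [AddCommGroup M] [Module A M]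
    [AddCommGroup M'] [Module A M'] : Prop :=
  ∃ r : ℕ, 0 < r ∧ ∃ φ : (Fin r → M) →ₗ[A] M', Function.Surjective φ

/-- `X ∈ add M`: `X` is a direct summand of a finite direct sum of copies
of `M`. -/
def InAdd (M X : Type u) [AddCommGroup M] [Module A M]
    [AddCommGroup X] [Module A X] : Prop :=
  ∃ (n : ℕ) (i : X →ₗ[A] (Fin n → M)) (p : (Fin n → M) →ₗ[A] X),
    p.comp i = LinearMap.id

/-- For a central idempotent `b` of `A`, the direct summand `b • N` of an
`A`-module `N`, realised as the submodule of elements on which `b` acts as the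
identity. -/
def blockComponent (b : A) (hb : ∀ r : A, b * r = r * b)
    (N : Type u) [AddCommGroup N] [Module A N] : Submodule A N where
  carrier := {n | b • n = n}
  add_mem' := by
    intro a c ha hc
    simp only [Set.mem_setOf_eq, smul_add] at *
    rw [ha, hc]
  zero_mem' := by simp
  smul_mem' := by
    intro r n hn
    simp only [Set.mem_setOf_eq] at *
    rw [← mul_smul, hb, mul_smul, hn]

end GeneralDefs

section InducedDefs

/-- `(N, j)` is the module induced from `M` along the ring homomorphism
`ι : R →+* S`, i.e. `N ≅ S ⊗_R M`, characterised by the universal property of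
extension of scalars: `j : M → N` is `R`-linear (with `R` acting on `N` via
`ι`) and every `R`-linear map from `M` to (the restriction of) an `S`-module
`X` factors uniquely through an `S`-linear map `N → X`. -/
def IsInducedMod {R S : Type u} [Ring R] [Ring S] (ι : R →+* S)
    (M : Type u) [AddCommGroup M] [Module R M]
    (N : Type u) [AddCommGroup N] [Module S N] (j : M →+ N) : Prop :=
  (∀ (r : R) (m : M), j (r • m) = ι r • j m) ∧
  ∀ (X : Type u) [AddCommGroup X] [Module S X] (f : M →+ X),
    (∀ (r : R) (m : M), f (r • m) = ι r • f m) →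
    ∃! g : N →ₗ[S] X, ∀ m : M, g (j m) = f m

end InducedDefs

section GroupDefs

variable (k : Type u) [Field k] (Gt : Type u) [Group Gt] (G : Subgroup Gt)
  [G.Normal]

/-- The ring automorphism of `kG` induced by conjugation by `x ∈ G̃` on the
normal subgroup `G`. -/
noncomputable def conjRingHom (x : Gt) :
    MonoidAlgebra k ↥G →+* MonoidAlgebra k ↥G :=
  MonoidAlgebra.mapDomainRingHom k (MulAut.conjNormal (H := G) x)

/-- The ring homomorphism `kG →+* kG̃` induced by the inclusion `G ≤ G̃`. -/
noncomputable def inclRingHom : MonoidAlgebra k ↥G →+* MonoidAlgebra k Gt :=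
  MonoidAlgebra.mapDomainRingHom k G.subtype

/-- `x M ≅ M`: the conjugate module `x M` (with `g` acting as `x⁻¹ g x` does
on `M`) is isomorphic to `M`; equivalently, there is an additive automorphism
of `M` which is semilinear for the conjugation automorphism of `kG`. -/
def IsConjStable (x : Gt) (M : Type u) [AddCommGroup M]
    [Module (MonoidAlgebra k ↥G) M] : Prop :=
  ∃ φ : M ≃+ M, ∀ (r : MonoidAlgebra k ↥G) (m : M),
    φ (conjRingHom k Gt G x r • m) = r • φ m

end GroupDefs

section Retract

variable (R : Type u) [Ring R]

/-- `X` is a retract (equivalently, isomorphic to a direct summand) of `M`. -/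
def IsRetract (X M : Type u) [AddCommGroup X] [Module R X] [AddCommGroup M] [Module R M] : Prop :=
  ∃ (i : X →ₗ[R] M) (p : M →ₗ[R] X), p ∘ₗ i = LinearMap.id

variable {R}
variable {X Y M N : Type u} [AddCommGroup X] [Module R X] [AddCommGroup Y] [Module R Y]
  [AddCommGroup M] [Module R M] [AddCommGroup N] [Module R N]

lemma IsRetract.trans (h : IsRetract R X Y) (h' : IsRetract R Y M) : IsRetract R X M := by
  obtain ⟨i, p, hp⟩ := h
  obtain ⟨i', p', hp'⟩ := h'
  refine ⟨i' ∘ₗ i, p ∘ₗ p', ?_⟩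
  rw [LinearMap.comp_assoc, ← LinearMap.comp_assoc i, hp', LinearMap.id_comp, hp]

lemma IsRetract.of_equiv (e : X ≃ₗ[R] M) : IsRetract R X M :=
  ⟨e, e.symm, by ext; simp⟩

lemma IsRetract.finite (h : IsRetract R X M) [Module.Finite R M] : Module.Finite R X := by
  obtain ⟨i, p, hp⟩ := h
  exact Module.Finite.of_surjective p fun x => ⟨i x, LinearMap.congr_fun hp x⟩

lemma IsRetract.projective (h : IsRetract R X M) [Module.Projective R M] :
    Module.Projective R X := by
  obtain ⟨i, p, hp⟩ := h
  exact Module.Projective.of_split i p hp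

lemma IsRetract.hom_eq_zero (h : IsRetract R X M) (h0 : ∀ f : M →ₗ[R] N, f = 0)
    (f : X →ₗ[R] N) : f = 0 := by
  obtain ⟨i, p, hp⟩ := h
  calc f = (f ∘ₗ p) ∘ₗ i := by rw [LinearMap.comp_assoc, hp, LinearMap.comp_id]
    _ = 0 := by rw [h0 (f ∘ₗ p), LinearMap.zero_comp]

lemma IsRetract.of_pi {ι : Type} [DecidableEq ι] (L : ι → Type u) [∀ s, AddCommGroup (L s)]
    [∀ s, Module R (L s)] (s : ι) : IsRetract R (L s) (∀ s, L s) :=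
  ⟨LinearMap.single R L s, LinearMap.proj s, by ext; simp⟩

lemma IsRetract.exists_isCompl (h : IsRetract R X M) :
    ∃ L : Submodule R M, (∃ L', IsCompl L L') ∧ Nonempty (X ≃ₗ[R] L) := by
  obtain ⟨i, p, hp⟩ := h
  have hpi : ∀ x, p (i x) = x := LinearMap.congr_fun hp
  refine ⟨LinearMap.range i, ⟨_, LinearMap.isCompl_of_proj (f := i.rangeRestrict ∘ₗ p) ?_⟩,
    ⟨LinearEquiv.ofInjective i (Function.LeftInverse.injective hpi)⟩⟩
  rintro ⟨_, x, rfl⟩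
  ext
  simp [hpi]

lemma IsRetract.of_isCompl {L L' : Submodule R M} (h : IsCompl L L') : IsRetract R L M :=
  ⟨L.subtype, L.projectionOnto L' h, by ext; simp⟩

lemma IsIndecModule.congr (e : X ≃ₗ[R] Y) (h : IsIndecModule R X) : IsIndecModule R Y := by
  obtain ⟨h1, h2⟩ := h
  refine ⟨e.symm.toEquiv.nontrivial, fun U V hUV => ?_⟩
  let o := Submodule.orderIsoMapComap e
  have := h2 (o.symm U) (o.symm V) (o.symm.isCompl_iff.mp hUV)
  simpa using this

/-- A nonzero retract of an indecomposable module is isomorphic to it. -/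
lemma IsIndecModule.equiv_of_retract (h : IsIndecModule R M) [Nontrivial X]
    (hX : IsRetract R X M) : Nonempty (X ≃ₗ[R] M) := by
  obtain ⟨L, ⟨L', hc⟩, ⟨e⟩⟩ := hX.exists_isCompl
  rcases h.2 L L' hc with h0 | h0
  · subst h0
    exact absurd (e.symm.toEquiv.nontrivial) (not_nontrivial _)
  · subst h0
    have : L = ⊤ := by simpa using hc.sup_eq_top
    subst this
    exact ⟨e.trans Submodule.topEquiv⟩

lemma IsIndecModule.isUnit_or_isNilpotent [IsNoetherian R X] [IsArtinian R X]
    (h : IsIndecModule R X) (f : Module.End R X) : IsUnit f ∨ IsNilpotent f := by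
  obtain ⟨n, hn, hn0⟩ := (f.eventually_isCompl_ker_pow_range_pow.and
    (Filter.eventually_ge_atTop 1)).exists
  rcases h.2 _ _ hn with h0 | h0
  · left
    rw [LinearMap.ker_eq_bot] at h0
    rw [← isUnit_pow_iff (n := n) (by omega), Module.End.isUnit_iff]
    exact ⟨h0, IsArtinian.surjective_of_injective_endomorphism _ h0⟩
  · exact .inr ⟨n, LinearMap.range_eq_bot.mp h0⟩

lemma IsIndecModule.isLocalRing_end [IsNoetherian R X] [IsArtinian R X]
    (h : IsIndecModule R X) (f g : Module.End R X) (hf : IsUnit (f + g)) :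
    IsUnit f ∨ IsUnit g := by
  obtain ⟨u, hu⟩ := hf
  have := h.1
  rcases h.isUnit_or_isNilpotent (↑u⁻¹ * f) with h1 | h1
  · left
    have := u.isUnit.mul h1
    rwa [← mul_assoc, Units.mul_inv, one_mul] at this
  · right
    have h2 := u.isUnit.mul h1.isUnit_one_sub
    have : (u : Module.End R X) * (1 - ↑u⁻¹ * f) = g := by
      rw [mul_sub, mul_one, ← mul_assoc, Units.mul_inv, one_mul, hu]
      abel
    rwa [this] at h2

lemma IsIndecModule.exists_isUnit_of_sum [IsNoetherian R X] [IsArtinian R X]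
    (h : IsIndecModule R X) {ι : Type*} (s : Finset ι) (f : ι → Module.End R X)
    (hf : IsUnit (∑ i ∈ s, f i)) : ∃ i ∈ s, IsUnit (f i) := by
  classical
  have := h.1
  induction s using Finset.induction_on with
  | empty => simp at hf
  | insert a s ha ih =>
    rw [Finset.sum_insert ha] at hf
    rcases h.isLocalRing_end _ _ hf with h1 | h1
    · exact ⟨a, by simp, h1⟩
    · obtain ⟨i, hi, hi'⟩ := ih h1
      exact ⟨i, by simp [hi], hi'⟩

/-- An indecomposable retract of a finite product is a retract of one of the factors. -/
lemma IsIndecModule.exists_retract_of_pi [IsNoetherian R X] [IsArtinian R X]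
    (h : IsIndecModule R X) {ι : Type} [Fintype ι] (L : ι → Type u) [∀ s, AddCommGroup (L s)]
    [∀ s, Module R (L s)] (hX : IsRetract R X (∀ s, L s)) : ∃ s, IsRetract R X (L s) := by
  classical
  obtain ⟨i, p, hp⟩ := hX
  obtain ⟨s, -, hs⟩ := h.exists_isUnit_of_sum Finset.univ
    (fun s => (p ∘ₗ LinearMap.single R L s) ∘ₗ (LinearMap.proj s ∘ₗ i)) (by
      convert isUnit_one
      ext x
      have := LinearMap.congr_fun hp x
      simp only [LinearMap.comp_apply, LinearMap.id_apply] at this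
      conv_rhs => rw [Module.End.one_apply, ← this]
      rw [LinearMap.sum_apply]
      simp only [LinearMap.comp_apply, LinearMap.proj_apply, LinearMap.coe_single]
      rw [← map_sum, Finset.univ_sum_single])
  obtain ⟨u, hu⟩ := hs
  refine ⟨s, LinearMap.proj s ∘ₗ i, (↑u⁻¹ : Module.End R X) ∘ₗ p ∘ₗ LinearMap.single R L s, ?_⟩
  have := u.inv_mul
  rw [hu] at this
  exact this

lemma IsIndecModule.exists_equiv_of_pi [IsNoetherian R X] [IsArtinian R X]
    (h : IsIndecModule R X) {ι : Type} [Fintype ι] (L : ι → Type u) [∀ s, AddCommGroup (L s)]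
    [∀ s, Module R (L s)] (hL : ∀ s, IsIndecModule R (L s)) (hX : IsRetract R X (∀ s, L s)) :
    ∃ s, Nonempty (X ≃ₗ[R] L s) := by
  have := h.1
  obtain ⟨s, hs⟩ := h.exists_retract_of_pi L hX
  exact ⟨s, (hL s).equiv_of_retract hs⟩

end Retract

section KrullSchmidt

variable {R : Type u} [Ring R]

/-- `M` is isomorphic to a finite product of indecomposable modules. -/
def HasIndecDecomp (R : Type u) [Ring R] (M : Type u) [AddCommGroup M] [Module R M] : Prop :=
  ∃ (n : ℕ) (L : Fin n → ModuleCat.{u} R), (∀ s, IsIndecModule R (L s)) ∧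
    Nonempty (M ≃ₗ[R] (∀ s, L s))

lemma HasIndecDecomp.of_fintype {M : Type u} [AddCommGroup M] [Module R M] {ι : Type} [Fintype ι]
    (L : ι → ModuleCat.{u} R) (hL : ∀ s, IsIndecModule R (L s)) (e : M ≃ₗ[R] (∀ s, L s)) :
    HasIndecDecomp R M :=
  ⟨Fintype.card ι, fun s => L ((Fintype.equivFin ι).symm s), fun _ => hL _,
    ⟨e.trans (LinearEquiv.piCongrLeft R (fun s => (L s : Type u))
      (Fintype.equivFin ι).symm).symm⟩⟩

lemma hasIndecDecomp_submodule {M : Type u} [AddCommGroup M] [Module R M] [IsArtinian R M]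
    (N : Submodule R M) : HasIndecDecomp R N := by
  induction N using WellFoundedLT.induction with
  | ind N ih =>
  by_cases h0 : Subsingleton N
  · exact HasIndecDecomp.of_fintype (ι := Empty) (fun s => s.elim) (fun s => s.elim)
      ⟨0, fun _ => 0, fun _ => Subsingleton.elim _ _, fun _ => Subsingleton.elim _ _⟩
  rw [not_subsingleton_iff_nontrivial] at h0
  by_cases h1 : IsIndecModule R N
  · exact HasIndecDecomp.of_fintype (ι := Unit) (fun _ => ModuleCat.of R N) (fun _ => h1)
      (LinearEquiv.funUnique Unit R N).symm
  have h2 : ∃ U V : Submodule R N, IsCompl U V ∧ U ≠ ⊥ ∧ V ≠ ⊥ := by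
    by_contra! h
    exact h1 ⟨h0, fun U V hUV => or_iff_not_imp_left.mpr (h U V hUV)⟩
  obtain ⟨U, V, hUV, hU, hV⟩ := h2
  have key : ∀ A B : Submodule R N, IsCompl A B → B ≠ ⊥ → HasIndecDecomp R A := by
    intro A B hAB hB
    have hlt : A.map N.subtype < N := by
      refine lt_of_le_of_ne (Submodule.map_subtype_le N A) fun h => hB ?_
      have : A = ⊤ := by
        apply Submodule.map_injective_of_injective N.injective_subtype
        simpa using h
      subst this
      simpa using hAB.inf_eq_bot
    obtain ⟨n, L, hL, ⟨e⟩⟩ := ih _ hlt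
    exact ⟨n, L, hL, ⟨(A.equivMapOfInjective N.subtype N.injective_subtype).trans e⟩⟩
  obtain ⟨n, L, hL, ⟨e⟩⟩ := key U V hUV hV
  obtain ⟨m, L', hL', ⟨e'⟩⟩ := key V U hUV.symm hU
  refine HasIndecDecomp.of_fintype (ι := Fin n ⊕ Fin m) (Sum.elim L L') ?_ ?_
  · rintro (s | s)
    · exact hL s
    · exact hL' s
  · exact (Submodule.prodEquivOfIsCompl U V hUV).symm.trans ((e.prodCongr e').trans
      (LinearEquiv.sumPiEquivProdPi R (Fin n) (Fin m)
        (fun s => (Sum.elim L L' s : ModuleCat.{u} R))).symm)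

lemma hasIndecDecomp (M : Type u) [AddCommGroup M] [Module R M] [IsArtinian R M] :
    HasIndecDecomp R M := by
  obtain ⟨n, L, hL, ⟨e⟩⟩ := hasIndecDecomp_submodule (⊤ : Submodule R M)
  exact ⟨n, L, hL, ⟨Submodule.topEquiv.symm.trans e⟩⟩

/-- A quotient by an equivalence relation whose classes are all represented in a finite family
has a finite irredundant system of representatives. -/
lemma exists_fin_reps {T : Type*} (r : T → T → Prop) (hr : Equivalence r) {ι : Type*} [Finite ι]
    (f : ι → T) (hf : ∀ t, ∃ i, r t (f i)) :
    ∃ g : Fin (Nat.card (Quot r)) → T, (∀ a b, r (g a) (g b) → a = b) ∧ ∀ t, ∃ a, r t (g a) := by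
  have hq : ∀ a b, Quot.mk r a = Quot.mk r b ↔ r a b := fun a b => by
    rw [Quot.eq, hr.eqvGen_iff]
  have : Finite (Quot r) := by
    refine Finite.of_surjective (fun i => Quot.mk r (f i)) fun q => ?_
    induction q using Quot.ind with
    | mk t =>
      obtain ⟨i, hi⟩ := hf t
      exact ⟨i, ((hq _ _).mpr hi).symm⟩
  let e := Finite.equivFin (Quot r)
  refine ⟨fun a => (e.symm a).out, fun a b hab => ?_, fun t => ⟨e (Quot.mk r t), ?_⟩⟩
  · rw [← hq, Quot.out_eq, Quot.out_eq] at hab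
    exact e.symm.injective hab
  · rw [← hq, Quot.out_eq, e.symm_apply_apply]

lemma natCard_quot_eq {T : Type*} (r : T → T → Prop) (hr : Equivalence r) {ι : Type*} [Fintype ι]
    (f : ι → T) (hinj : ∀ a b, r (f a) (f b) → a = b) (hf : ∀ t, ∃ i, r t (f i)) :
    Nat.card (Quot r) = Fintype.card ι := by
  have hq : ∀ a b, Quot.mk r a = Quot.mk r b ↔ r a b := fun a b => by
    rw [Quot.eq, hr.eqvGen_iff]
  rw [← Nat.card_eq_fintype_card]
  refine (Nat.card_congr (Equiv.ofBijective (fun i => Quot.mk r (f i)) ⟨fun a b hab => ?_,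
    fun q => ?_⟩)).symm
  · exact hinj a b ((hq _ _).mp hab)
  · induction q using Quot.ind with
    | mk t =>
      obtain ⟨i, hi⟩ := hf t
      exact ⟨i, ((hq _ _).mpr hi).symm⟩

variable {M : Type u} [AddCommGroup M] [Module R M]

lemma equivalence_linearEquiv {T : Type*} (F : T → ModuleCat.{u} R) :
    Equivalence fun a b => Nonempty (F a ≃ₗ[R] F b) :=
  ⟨fun _ => ⟨.refl _ _⟩, fun ⟨e⟩ => ⟨e.symm⟩, fun ⟨e⟩ ⟨e₂⟩ => ⟨e.trans e₂⟩⟩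

/-- Representatives of the isomorphism classes of indecomposable direct summands. -/
lemma exists_indec_reps (M : Type u) [AddCommGroup M] [Module R M] [IsArtinian R M]
    [IsNoetherian R M] :
    ∃ L : Fin (numIndec R M) → ModuleCat.{u} R, (∀ s, IsIndecModule R (L s)) ∧
      (∀ s, IsRetract R (L s) M) ∧ (∀ s t, Nonempty (L s ≃ₗ[R] L t) → s = t) ∧
      ∀ (Y : Type u) [AddCommGroup Y] [Module R Y], IsIndecModule R Y → IsRetract R Y M →
        ∃ s, Nonempty (Y ≃ₗ[R] L s) := by
  obtain ⟨n, L, hL, ⟨e⟩⟩ := hasIndecDecomp (R := R) M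
  have hLM : ∀ s, IsRetract R (L s) M := fun s =>
    (IsRetract.of_pi (R := R) (fun s => (L s : Type u)) s).trans (.of_equiv e.symm)
  choose K hK eK using fun s => (hLM s).exists_isCompl
  let T := {L : Submodule R M // (∃ L'', IsCompl L L'') ∧ IsIndecModule R L}
  have hT : ∀ (Y : Type u) [AddCommGroup Y] [Module R Y] [IsArtinian R Y] [IsNoetherian R Y],
      IsIndecModule R Y → IsRetract R Y M → ∃ s, Nonempty (Y ≃ₗ[R] K s) := by
    intro Y _ _ _ _ hY hYM
    obtain ⟨s, ⟨e'⟩⟩ := hY.exists_equiv_of_pi (fun s => (L s : Type u)) hL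
      (hYM.trans (.of_equiv e))
    exact ⟨s, ⟨e'.trans (eK s).some⟩⟩
  obtain ⟨g, hg, hg'⟩ := exists_fin_reps (T := T) (fun L L' => Nonempty (L.1 ≃ₗ[R] L'.1))
    (equivalence_linearEquiv fun t : T => ModuleCat.of R t.1) (ι := Fin n)
    (fun s => ⟨K s, hK s, (hL s).congr (eK s).some⟩) (fun t => by
      obtain ⟨L', hL'⟩ := t.2.1
      exact hT t.1 t.2.2 (.of_isCompl hL'))
  refine ⟨fun a => ModuleCat.of R (g a).1, fun a => (g a).2.2, fun a => ?_,
    fun a b => hg a b, fun Y _ _ hY hYM => ?_⟩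
  · obtain ⟨L', hL'⟩ := (g a).2.1
    exact .of_isCompl hL'
  · obtain ⟨K', hK', ⟨e'⟩⟩ := hYM.exists_isCompl
    obtain ⟨a, ⟨ha⟩⟩ := hg' ⟨K', hK', hY.congr e'⟩
    exact ⟨a, ⟨e'.trans ha⟩⟩

lemma numIndec_eq_card {M : Type u} [AddCommGroup M] [Module R M] [IsArtinian R M]
    [IsNoetherian R M] {ι : Type} [Fintype ι] (L : ι → ModuleCat.{u} R)
    (hL : ∀ s, IsIndecModule R (L s)) (hinj : ∀ s t, Nonempty (L s ≃ₗ[R] L t) → s = t)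
    (e : M ≃ₗ[R] (∀ s, L s)) : numIndec R M = Fintype.card ι := by
  classical
  have hLM : ∀ s, IsRetract R (L s) M := fun s =>
    (IsRetract.of_pi (R := R) (fun s => (L s : Type u)) s).trans (.of_equiv e.symm)
  choose K hK eK using fun s => (hLM s).exists_isCompl
  let T := {L : Submodule R M // (∃ L'', IsCompl L L'') ∧ IsIndecModule R L}
  refine natCard_quot_eq (T := T) _
    (equivalence_linearEquiv fun t : T => ModuleCat.of R t.1)
    (fun s => ⟨K s, hK s, (hL s).congr (eK s).some⟩) (fun a b ⟨h⟩ => ?_) (fun t => ?_)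
  · exact hinj a b ⟨((eK a).some.trans h).trans (eK b).some.symm⟩
  · obtain ⟨L', hL'⟩ := t.2.1
    obtain ⟨s, ⟨e'⟩⟩ := t.2.2.exists_equiv_of_pi (fun s => (L s : Type u)) hL
      ((IsRetract.of_isCompl hL').trans (.of_equiv e))
    exact ⟨s, ⟨e'.trans (eK s).some⟩⟩

end KrullSchmidt

section Presentations

variable {R : Type u} [Ring R]

section Basic

variable {Q₀ Q₁ X Y M N : Type u} [AddCommGroup Q₀] [Module R Q₀] [AddCommGroup Q₁] [Module R Q₁]
  [AddCommGroup X] [Module R X] [AddCommGroup Y] [Module R Y]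
  [AddCommGroup M] [Module R M] [AddCommGroup N] [Module R N]

/-- Every map `Q₁ → X` extends along `d : Q₁ → Q₀`.  When `d` is a presentation by projectives
this says that `X` is right perpendicular to the shifted two-term complex. -/
def ExtendsAlong (d : Q₁ →ₗ[R] Q₀) (X : Type u) [AddCommGroup X] [Module R X] : Prop :=
  ∀ f : Q₁ →ₗ[R] X, ∃ h : Q₀ →ₗ[R] X, h ∘ₗ d = f

/-- `X` is generated by `M`: it is a quotient of a finite direct sum of copies of `M`. -/
def IsGenBy (R : Type u) [Ring R] (M X : Type u) [AddCommGroup M] [Module R M] [AddCommGroup X]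
    [Module R X] : Prop :=
  ∃ (r : ℕ) (u : (Fin r → M) →ₗ[R] X), Function.Surjective u

lemma ExtendsAlong.of_surjective [Module.Projective R Q₁] {d : Q₁ →ₗ[R] Q₀}
    (h : ExtendsAlong d X) (u : X →ₗ[R] Y) (hu : Function.Surjective u) : ExtendsAlong d Y := by
  intro f
  obtain ⟨g, rfl⟩ := Module.projective_lifting_property u f hu
  obtain ⟨e, rfl⟩ := h g
  exact ⟨u ∘ₗ e, by rw [LinearMap.comp_assoc]⟩

lemma ExtendsAlong.pi {ι : Type} {L : ι → Type u} [∀ s, AddCommGroup (L s)]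
    [∀ s, Module R (L s)] {d : Q₁ →ₗ[R] Q₀} (h : ∀ s, ExtendsAlong d (L s)) :
    ExtendsAlong d (∀ s, L s) := by
  intro f
  choose e he using fun s => h s (LinearMap.proj s ∘ₗ f)
  refine ⟨LinearMap.pi e, ?_⟩
  ext x s
  exact LinearMap.congr_fun (he s) x

lemma ExtendsAlong.of_isGenBy [Module.Projective R Q₁] {d : Q₁ →ₗ[R] Q₀}
    (h : ExtendsAlong d M) (hX : IsGenBy R M X) : ExtendsAlong d X := by
  obtain ⟨r, u, hu⟩ := hX
  exact (ExtendsAlong.pi (L := fun _ : Fin r => M) fun _ => h).of_surjective u hu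

lemma ExtendsAlong.of_isRetract {d : Q₁ →ₗ[R] Q₀} (h : ExtendsAlong d M)
    (hX : IsRetract R X M) : ExtendsAlong d X := by
  obtain ⟨i, p, hp⟩ := hX
  intro f
  obtain ⟨e, he⟩ := h (i ∘ₗ f)
  refine ⟨p ∘ₗ e, ?_⟩
  rw [LinearMap.comp_assoc, he, ← LinearMap.comp_assoc, hp, LinearMap.id_comp]

lemma hom_eq_zero_of_isGenBy {P : Type u} [AddCommGroup P] [Module R P] [Module.Projective R P]
    (h : ∀ f : P →ₗ[R] M, f = 0) (hX : IsGenBy R M X) (f : P →ₗ[R] X) : f = 0 := by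
  obtain ⟨r, u, hu⟩ := hX
  obtain ⟨g, rfl⟩ := Module.projective_lifting_property u f hu
  have : g = 0 := by
    ext x s
    exact LinearMap.congr_fun (h (LinearMap.proj s ∘ₗ g)) x
  rw [this, LinearMap.comp_zero]

lemma IsRetract.isGenBy (h : IsRetract R X M) : IsGenBy R M X := by
  obtain ⟨i, p, hp⟩ := h
  exact ⟨1, p ∘ₗ LinearMap.proj 0, fun x => ⟨fun _ => i x, LinearMap.congr_fun hp x⟩⟩

lemma IsGenBy.of_surjective (u : M →ₗ[R] X) (hu : Function.Surjective u) : IsGenBy R M X :=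
  ⟨1, u ∘ₗ LinearMap.proj 0, fun x => by
    obtain ⟨m, rfl⟩ := hu x
    exact ⟨fun _ => m, rfl⟩⟩

lemma IsGenBy.trans (h : IsGenBy R M N) (h' : IsGenBy R N X) : IsGenBy R M X := by
  obtain ⟨r, u, hu⟩ := h
  obtain ⟨s, v, hv⟩ := h'
  let w : (Fin s × Fin r → M) →ₗ[R] (Fin s → N) :=
    LinearMap.pi fun a => u ∘ₗ LinearMap.pi fun b => LinearMap.proj (a, b)
  have hw : Function.Surjective w := fun y => by
    choose z hz using fun a => hu (y a)
    exact ⟨fun c => z c.1 c.2, funext fun a => hz a⟩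
  refine ⟨s * r, (v ∘ₗ w) ∘ₗ (LinearMap.funLeft R M finProdFinEquiv), ?_⟩
  rw [LinearMap.coe_comp]
  exact Function.Surjective.comp (by rw [LinearMap.coe_comp]; exact hv.comp hw)
    (LinearMap.funLeft_surjective_of_injective _ _ _ finProdFinEquiv.injective)

lemma exists_projCover [IsArtinianRing R] (M : Type u) [AddCommGroup M] [Module R M]
    [Module.Finite R M] : ∃ (P : ModuleCat.{u} R) (π : P →ₗ[R] M), Module.Finite R P ∧
      IsProjCover R π := by
  obtain ⟨n, π, hπ⟩ := Module.Finite.exists_fin' R M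
  let S : Set (Submodule R (Fin n → R)) :=
    {N | Module.Projective R N ∧ Function.Surjective (π.domRestrict N)}
  have hS : S.Nonempty := ⟨⊤, Module.Projective.of_equiv Submodule.topEquiv.symm, fun m => by
    obtain ⟨x, rfl⟩ := hπ m
    exact ⟨⟨x, trivial⟩, rfl⟩⟩
  obtain ⟨N, ⟨hNp, hNs⟩, hmin⟩ := WellFounded.has_min (wellFounded_lt) S hS
  refine ⟨ModuleCat.of R N, π.domRestrict N, inferInstanceAs (Module.Finite R N), hNp, hNs, ?_⟩
  change ∀ N' : Submodule R N, _
  intro N' hN'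
  have hs' : Function.Surjective ((π.domRestrict N).domRestrict N') := by
    intro m
    obtain ⟨x, rfl⟩ := hNs m
    have : x ∈ N' ⊔ LinearMap.ker (π.domRestrict N) := hN' ▸ trivial
    obtain ⟨y, hy, z, hz, rfl⟩ := Submodule.mem_sup.mp this
    refine ⟨⟨y, hy⟩, ?_⟩
    rw [map_add, LinearMap.mem_ker.mp hz, add_zero]
    rfl
  obtain ⟨θ, hθ⟩ := Module.projective_lifting_property _ (π.domRestrict N) hs'
  let φ : Module.End R N := N'.subtype ∘ₗ θ
  have hφ : ∀ x, π.domRestrict N (φ x) = π.domRestrict N x := fun x => LinearMap.congr_fun hθ x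
  have hφn : ∀ (k : ℕ) x, π.domRestrict N ((φ ^ k) x) = π.domRestrict N x := by
    intro k
    induction k with
    | zero => simp
    | succ k ih => intro x; rw [pow_succ', Module.End.mul_apply, hφ, ih]
  obtain ⟨k, hk, hk1⟩ := (φ.eventually_isCompl_ker_pow_range_pow.and
    (Filter.eventually_ge_atTop 1)).exists
  have hr : LinearMap.range (φ ^ k) = ⊤ := by
    by_contra hne
    refine hmin ((LinearMap.range (φ ^ k)).map N.subtype) ⟨?_, ?_⟩ ?_
    · have := (IsRetract.of_isCompl hk.symm).projective
      exact Module.Projective.of_equiv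
        ((LinearMap.range (φ ^ k)).equivMapOfInjective N.subtype N.injective_subtype)
    · intro m
      obtain ⟨x, rfl⟩ := hNs m
      exact ⟨⟨_, _, ⟨x, rfl⟩, rfl⟩, hφn k x⟩
    · refine lt_of_le_of_ne (Submodule.map_subtype_le N _) fun h => hne ?_
      apply Submodule.map_injective_of_injective N.injective_subtype
      simpa using h
  rw [eq_top_iff, ← hr]
  rintro _ ⟨x, rfl⟩
  obtain ⟨l, rfl⟩ : ∃ l, k = l + 1 := ⟨k - 1, by omega⟩
  rw [pow_succ', Module.End.mul_apply]
  exact (θ _).2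

end Basic

/-- A presentation of `M` by finitely generated projective modules. -/
structure ProjPres (R : Type u) [Ring R] (M : Type u) [AddCommGroup M] [Module R M] where
  P₀ : Type u
  P₁ : Type u
  [addCommGroup₀ : AddCommGroup P₀]
  [addCommGroup₁ : AddCommGroup P₁]
  [module₀ : Module R P₀]
  [module₁ : Module R P₁]
  [projective₀ : Module.Projective R P₀]
  [projective₁ : Module.Projective R P₁]
  [finite₀ : Module.Finite R P₀]
  [finite₁ : Module.Finite R P₁]
  d : P₁ →ₗ[R] P₀
  π : P₀ →ₗ[R] M
  exact : Function.Exact d π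
  surj : Function.Surjective π

attribute [instance] ProjPres.addCommGroup₀ ProjPres.addCommGroup₁ ProjPres.module₀
  ProjPres.module₁ ProjPres.projective₀ ProjPres.projective₁ ProjPres.finite₀ ProjPres.finite₁

variable {M N X : Type u} [AddCommGroup M] [Module R M] [AddCommGroup N] [Module R N]
  [AddCommGroup X] [Module R X]

namespace ProjPres

/-- The presentation is minimal. -/
def IsMin (e : ProjPres R M) : Prop :=
  (∀ N, N ⊔ LinearMap.ker e.π = ⊤ → N = ⊤) ∧ ∀ N, N ⊔ LinearMap.ker e.d = ⊤ → N = ⊤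

lemma π_d (e : ProjPres R M) (x : e.P₁) : e.π (e.d x) = 0 := e.exact.apply_apply_eq_zero x

/-- The presentation of a module obtained from two consecutive projective covers. -/
def ofProjCover {P₀ P₁ : Type u} [AddCommGroup P₀] [Module R P₀] [AddCommGroup P₁] [Module R P₁]
    [Module.Finite R P₀] [Module.Finite R P₁]
    (π₀ : P₀ →ₗ[R] M) (h₀ : IsProjCover R π₀) (π₁ : P₁ →ₗ[R] LinearMap.ker π₀)
    (h₁ : IsProjCover R π₁) : ProjPres R M :=
  have := h₀.1
  have := h₁.1
  { P₀ := P₀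
    P₁ := P₁
    d := (LinearMap.ker π₀).subtype ∘ₗ π₁
    π := π₀
    exact := fun x => ⟨fun hx => by
      obtain ⟨y, hy⟩ := h₁.2.1 ⟨x, hx⟩
      exact ⟨y, by simp [hy]⟩, by rintro ⟨y, rfl⟩; exact (π₁ y).2⟩
    surj := h₀.2.1 }

lemma ofProjCover_isMin {P₀ P₁ : Type u} [AddCommGroup P₀] [Module R P₀] [AddCommGroup P₁]
    [Module R P₁] [Module.Finite R P₀] [Module.Finite R P₁]
    (π₀ : P₀ →ₗ[R] M) (h₀ : IsProjCover R π₀) (π₁ : P₁ →ₗ[R] LinearMap.ker π₀)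
    (h₁ : IsProjCover R π₁) : (ofProjCover π₀ h₀ π₁ h₁).IsMin := by
  refine ⟨h₀.2.2, fun N hN => h₁.2.2 N ?_⟩
  have : LinearMap.ker ((LinearMap.ker π₀).subtype ∘ₗ π₁) = LinearMap.ker π₁ :=
    LinearMap.ker_comp_of_ker_eq_bot _ (Submodule.ker_subtype _)
  rw [← this]
  exact hN

lemma exists_isMin [IsArtinianRing R] (M : Type u) [AddCommGroup M] [Module R M]
    [Module.Finite R M] : ∃ e : ProjPres R M, e.IsMin := by
  obtain ⟨P₀, π₀, hf₀, h₀⟩ := exists_projCover (R := R) M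
  obtain ⟨P₁, π₁, hf₁, h₁⟩ := exists_projCover (R := R) (LinearMap.ker π₀)
  exact ⟨_, ofProjCover_isMin π₀ h₀ π₁ h₁⟩

/-- Maps of modules lift to maps of projective presentations. -/
lemma exists_lift (e : ProjPres R M) (e' : ProjPres R N) (f : M →ₗ[R] N) :
    ∃ (a₀ : e.P₀ →ₗ[R] e'.P₀) (a₁ : e.P₁ →ₗ[R] e'.P₁),
      (∀ x, e'.π (a₀ x) = f (e.π x)) ∧ ∀ x, e'.d (a₁ x) = a₀ (e.d x) := by
  obtain ⟨a₀, h₀⟩ := Module.projective_lifting_property e'.π (f ∘ₗ e.π) e'.surj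
  have h₀' : ∀ x, e'.π (a₀ x) = f (e.π x) := LinearMap.congr_fun h₀
  let a : e.P₁ →ₗ[R] LinearMap.ker e'.π := (a₀ ∘ₗ e.d).codRestrict _ fun x => by
    simp [h₀', e.π_d]
  let b : e'.P₁ →ₗ[R] LinearMap.ker e'.π := e'.d.codRestrict _ fun x => by simp [e'.π_d]
  obtain ⟨a₁, h₁⟩ := Module.projective_lifting_property b a fun ⟨x, hx⟩ => by
    obtain ⟨y, rfl⟩ := (e'.exact x).mp hx
    exact ⟨y, rfl⟩
  exact ⟨a₀, a₁, h₀', fun x => congrArg Subtype.val (LinearMap.congr_fun h₁ x)⟩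

lemma IsMin.bijective [IsArtinianRing R] {e : ProjPres R M} (he : e.IsMin)
    (a₀ : e.P₀ →ₗ[R] e.P₀) (a₁ : e.P₁ →ₗ[R] e.P₁) (h₀ : ∀ x, e.π (a₀ x) = e.π x)
    (h₁ : ∀ x, e.d (a₁ x) = a₀ (e.d x)) : Function.Bijective a₀ ∧ Function.Bijective a₁ := by
  have s₀ : Function.Surjective a₀ := by
    rw [← LinearMap.range_eq_top]
    refine he.1 _ (eq_top_iff.mpr fun x _ => ?_)
    rw [← add_sub_cancel (a₀ x) x]
    exact Submodule.add_mem_sup ⟨x, rfl⟩ (by simp [h₀])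
  have i₀ := IsNoetherian.injective_of_surjective_endomorphism a₀ s₀
  have s₁ : Function.Surjective a₁ := by
    rw [← LinearMap.range_eq_top]
    refine he.2 _ (eq_top_iff.mpr fun y _ => ?_)
    obtain ⟨x, hx⟩ := s₀ (e.d y)
    obtain ⟨z, rfl⟩ := (e.exact x).mp (by rw [← h₀, hx, e.π_d])
    rw [← add_sub_cancel (a₁ z) y]
    exact Submodule.add_mem_sup ⟨z, rfl⟩ (by simp [h₁, hx])
  exact ⟨⟨i₀, s₀⟩, ⟨IsNoetherian.injective_of_surjective_endomorphism a₁ s₁, s₁⟩⟩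

/-- A minimal presentation of a retract of `N` is a retract of any presentation of `N`. -/
lemma IsMin.exists_retract [IsArtinianRing R] {e : ProjPres R M} (he : e.IsMin)
    (c : ProjPres R N) (i : M →ₗ[R] N) (p : N →ₗ[R] M) (hpi : p ∘ₗ i = LinearMap.id) :
    ∃ (i₀ : e.P₀ →ₗ[R] c.P₀) (i₁ : e.P₁ →ₗ[R] c.P₁) (p₀ : c.P₀ →ₗ[R] e.P₀)
      (p₁ : c.P₁ →ₗ[R] e.P₁), (∀ x, c.d (i₁ x) = i₀ (e.d x)) ∧ (∀ x, e.d (p₁ x) = p₀ (c.d x)) ∧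
      (∀ x, p₀ (i₀ x) = x) ∧ (∀ x, p₁ (i₁ x) = x) ∧ ∀ x, e.π (p₀ x) = p (c.π x) := by
  obtain ⟨i₀, i₁, hi, hdi⟩ := e.exists_lift c i
  obtain ⟨b₀, b₁, hb, hdb⟩ := c.exists_lift e p
  have hπ : ∀ x, e.π (b₀ (i₀ x)) = e.π x := fun x => by
    rw [hb, hi]
    exact LinearMap.congr_fun hpi _
  obtain ⟨h₀, h₁⟩ := he.bijective (b₀ ∘ₗ i₀) (b₁ ∘ₗ i₁) hπ (fun x => by simp [hdi, hdb])
  let u₀ := LinearEquiv.ofBijective _ h₀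
  let u₁ := LinearEquiv.ofBijective _ h₁
  have hu₀ : ∀ x, u₀ x = b₀ (i₀ x) := fun _ => rfl
  have hu₁ : ∀ x, u₁ x = b₁ (i₁ x) := fun _ => rfl
  refine ⟨i₀, i₁, u₀.symm.toLinearMap ∘ₗ b₀, u₁.symm.toLinearMap ∘ₗ b₁, hdi, fun x => ?_,
    fun x => ?_, fun x => ?_, fun x => ?_⟩
  · apply u₀.injective
    simp only [LinearMap.comp_apply, LinearEquiv.coe_coe, LinearEquiv.apply_symm_apply]
    rw [← hdb, hu₀, ← hdi, ← hdb, ← hu₁, LinearEquiv.apply_symm_apply]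
  · simp [← hu₀]
  · simp [← hu₁]
  · have := hπ (u₀.symm (b₀ x))
    rw [← hu₀, LinearEquiv.apply_symm_apply, hb] at this
    exact this.symm

lemma IsMin.extendsAlong [IsArtinianRing R] {e : ProjPres R M} (he : e.IsMin)
    (c : ProjPres R N) (hMN : IsRetract R M N) (h : ExtendsAlong c.d X) :
    ExtendsAlong e.d X := by
  obtain ⟨i, p, hpi⟩ := hMN
  obtain ⟨i₀, i₁, p₀, p₁, hi, hp, hpi₀, hpi₁, -⟩ := he.exists_retract c i p hpi
  intro f
  obtain ⟨g, hg⟩ := h (f ∘ₗ p₁)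
  refine ⟨g ∘ₗ i₀, ?_⟩
  ext x
  have := LinearMap.congr_fun hg (i₁ x)
  simpa [hi, hpi₁] using this

end ProjPres

lemma exists_split_of_projective {P Q : Type u} [AddCommGroup P] [Module R P] [AddCommGroup Q]
    [Module R Q] [Module.Projective R Q] (p : P →ₗ[R] Q) (hp : Function.Surjective p) :
    ∃ ρ : P →ₗ[R] LinearMap.ker p, (∀ x, ρ x.1 = x) ∧
      Nonempty (P ≃ₗ[R] Q × LinearMap.ker p) := by
  obtain ⟨s, hs⟩ := Module.projective_lifting_property p LinearMap.id hp
  have hs' : ∀ x, p (s x) = x := LinearMap.congr_fun hs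
  let ρ : P →ₗ[R] LinearMap.ker p := (LinearMap.id - s ∘ₗ p).codRestrict _ fun x => by simp [hs']
  have hρ : ∀ x, (ρ x : P) = x - s (p x) := fun _ => rfl
  refine ⟨ρ, fun x => Subtype.ext ?_, ⟨LinearEquiv.ofBijective (p.prod ρ) ⟨fun x y hxy => ?_,
    fun ⟨q, k⟩ => ⟨s q + k, ?_⟩⟩⟩⟩
  · simp [hρ]
  · have h1 : p x = p y := congrArg Prod.fst hxy
    have h2 : (ρ x : P) = ρ y := congrArg (fun z => (z.2 : P)) hxy
    rw [hρ, hρ, h1] at h2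
    simpa using h2
  · refine Prod.ext (by simp [hs']) (Subtype.ext ?_)
    simp [hρ, hs']

/-- Any presentation is the sum of a minimal one, a contractible one and a projective module `K`
placed in degree one. -/
lemma ProjPres.IsMin.exists_equiv_prod [IsArtinianRing R] {e : ProjPres R M} (he : e.IsMin)
    (c : ProjPres R M) : ∃ E K : ModuleCat.{u} R, Module.Projective R K ∧ Module.Finite R K ∧
      Nonempty (c.P₀ ≃ₗ[R] e.P₀ × E) ∧ Nonempty (c.P₁ ≃ₗ[R] e.P₁ × (E × K)) ∧
      ∀ (X : Type u) [AddCommGroup X] [Module R X], ExtendsAlong c.d X →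
        ∀ f : K →ₗ[R] X, f = 0 := by
  obtain ⟨i₀, i₁, p₀, p₁, hi, hp, hpi₀, hpi₁, hπ⟩ :=
    he.exists_retract c LinearMap.id LinearMap.id rfl
  obtain ⟨ρ₀, hρ₀, ⟨e₀⟩⟩ := exists_split_of_projective p₀ fun x => ⟨_, hpi₀ x⟩
  obtain ⟨ρ₁, hρ₁, ⟨e₁⟩⟩ := exists_split_of_projective p₁ fun x => ⟨_, hpi₁ x⟩
  have pr₀ : Module.Projective R (LinearMap.ker p₀) :=
    Module.Projective.of_split (LinearMap.ker p₀).subtype ρ₀ (LinearMap.ext hρ₀)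
  have r₁ : IsRetract R (LinearMap.ker p₁) c.P₁ :=
    ⟨Submodule.subtype _, ρ₁, LinearMap.ext hρ₁⟩
  let δ : LinearMap.ker p₁ →ₗ[R] LinearMap.ker p₀ :=
    (c.d ∘ₗ Submodule.subtype _).codRestrict _ fun x => by simp [← hp]
  have hδ : Function.Surjective δ := by
    rintro ⟨x, hx⟩
    have hx0 : c.π x = 0 := by
      have := hπ x
      rw [LinearMap.mem_ker.mp hx, map_zero] at this
      exact this.symm
    obtain ⟨y, rfl⟩ := (c.exact x).mp hx0
    refine ⟨⟨y - i₁ (p₁ y), by simp [hpi₁]⟩, Subtype.ext ?_⟩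
    have : p₀ (c.d y) = 0 := hx
    change c.d (y - i₁ (p₁ y)) = c.d y
    rw [map_sub, hi, hp, this, map_zero, sub_zero]
  obtain ⟨ρ, hρ, ⟨e₂⟩⟩ := exists_split_of_projective δ hδ
  have r₂ : IsRetract R (LinearMap.ker δ) c.P₁ :=
    IsRetract.trans ⟨Submodule.subtype _, ρ, LinearMap.ext hρ⟩ r₁
  refine ⟨ModuleCat.of R (LinearMap.ker p₀), ModuleCat.of R (LinearMap.ker δ),
    r₂.projective, r₂.finite, ⟨e₀⟩, ⟨e₁.trans ((LinearEquiv.refl R _).prodCongr e₂)⟩, ?_⟩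
  intro X _ _ hX f
  obtain ⟨h, hh⟩ := hX (f ∘ₗ ρ ∘ₗ ρ₁)
  ext x
  have h1 := LinearMap.congr_fun hh x.1.1
  have h2 : c.d x.1.1 = 0 := congrArg Subtype.val (LinearMap.mem_ker.mp x.2)
  simp only [LinearMap.comp_apply, h2, map_zero, hρ₁] at h1
  rw [hρ] at h1
  exact h1.symm

end Presentations

section HomDim

variable (k : Type u) [Field k] {R : Type u} [Ring R] [Algebra k R]

/-- The `k`-dimension of the space of homomorphisms between two modules over a `k`-algebra. -/
noncomputable def homDim (X Y : Type u) [AddCommGroup X] [Module R X] [AddCommGroup Y]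
    [Module R Y] : ℕ :=
  letI : Module k Y := Module.compHom Y (algebraMap k R)
  haveI : IsScalarTower k R Y := ⟨fun c r y => by rw [Algebra.smul_def, mul_smul]; rfl⟩
  haveI : SMulCommClass R k Y := IsScalarTower.to_smulCommClass'
  Module.finrank k (X →ₗ[R] Y)

variable {X Y Z W : Type u} [AddCommGroup X] [Module R X] [AddCommGroup Y] [Module R Y]
  [AddCommGroup Z] [Module R Z] [AddCommGroup W] [Module R W]

lemma exists_scalars (R : Type u) [Ring R] [Algebra k R] (Y : Type u) [AddCommGroup Y]
    [Module R Y] : ∃ _ : Module k Y, IsScalarTower k R Y :=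
  letI : Module k Y := Module.compHom Y (algebraMap k R)
  ⟨inferInstance, ⟨fun c r y => by rw [Algebra.smul_def, mul_smul]; rfl⟩⟩

lemma homDim_eq [m : Module k Y] [IsScalarTower k R Y] [SMulCommClass R k Y] :
    homDim k (R := R) X Y = Module.finrank k (X →ₗ[R] Y) := by
  have : m = Module.compHom Y (algebraMap k R) := by
    ext c y
    exact (algebraMap_smul R c y).symm
  subst this
  rfl

lemma finite_scalars [Module.Finite k R] [Module.Finite R Y] [Module k Y] [IsScalarTower k R Y] :
    Module.Finite k Y := Module.Finite.trans R Y

lemma finite_hom [Module.Finite k R] [Module.Finite R X] [Module.Finite R Y] [Module k Y]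
    [IsScalarTower k R Y] [SMulCommClass R k Y] : Module.Finite k (X →ₗ[R] Y) := by
  have := finite_scalars k (R := R) (Y := Y)
  obtain ⟨n, s, hs⟩ := Module.Finite.exists_fin (R := R) (M := X)
  let ev : (X →ₗ[R] Y) →ₗ[k] (Fin n → Y) :=
    { toFun := fun f i => f (s i), map_add' := fun _ _ => rfl, map_smul' := fun _ _ => rfl }
  refine Module.Finite.of_injective ev fun f g hfg => LinearMap.ext_on_range hs fun i => ?_
  exact congrFun hfg i

variable (R) in
/-- Postcomposition as a `k`-linear map. -/
def postcomp [Module k Y] [IsScalarTower k R Y] [SMulCommClass R k Y] [Module k Z]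
    [IsScalarTower k R Z] [SMulCommClass R k Z] (X : Type u) [AddCommGroup X] [Module R X]
    (p : Y →ₗ[R] Z) : (X →ₗ[R] Y) →ₗ[k] (X →ₗ[R] Z) where
  toFun f := p ∘ₗ f
  map_add' f g := by ext; simp
  map_smul' c f := by
    ext x
    simp only [LinearMap.comp_apply, LinearMap.smul_apply, RingHom.id_apply]
    rw [← algebraMap_smul R c (f x), map_smul, algebraMap_smul]

variable (R) in
/-- Precomposition as a `k`-linear map. -/
def precomp [Module k Z] [IsScalarTower k R Z] [SMulCommClass R k Z] (d : X →ₗ[R] Y) :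
    (Y →ₗ[R] Z) →ₗ[k] (X →ₗ[R] Z) where
  toFun f := f ∘ₗ d
  map_add' _ _ := rfl
  map_smul' _ _ := rfl

lemma homDim_congr_left (e : X ≃ₗ[R] Y) : homDim k (R := R) X Z = homDim k (R := R) Y Z := by
  obtain ⟨_, _⟩ := exists_scalars k R Z
  have : SMulCommClass R k Z := IsScalarTower.to_smulCommClass'
  rw [homDim_eq, homDim_eq]
  refine LinearEquiv.finrank_eq (LinearEquiv.ofBijective (precomp k R e.symm.toLinearMap)
    ⟨fun f g h => ?_, fun f => ⟨f ∘ₗ e.toLinearMap, ?_⟩⟩)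
  · ext x
    simpa [precomp] using LinearMap.congr_fun h (e x)
  · ext y
    simp [precomp]

lemma homDim_eq_zero_iff [Module.Finite k R] [Module.Finite R X] [Module.Finite R Y] :
    homDim k (R := R) X Y = 0 ↔ ∀ f : X →ₗ[R] Y, f = 0 := by
  obtain ⟨_, _⟩ := exists_scalars k R Y
  have : SMulCommClass R k Y := IsScalarTower.to_smulCommClass'
  have := finite_hom k (R := R) (X := X) (Y := Y)
  rw [homDim_eq, Module.finrank_eq_zero_iff_of_free, subsingleton_iff_forall_eq 0]

lemma homDim_pi_left [Module.Finite k R] {ι : Type} [Fintype ι] (L : ι → Type u)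
    [∀ s, AddCommGroup (L s)] [∀ s, Module R (L s)] [∀ s, Module.Finite R (L s)]
    [Module.Finite R Z] :
    homDim k (R := R) (∀ s, L s) Z = ∑ s, homDim k (R := R) (L s) Z := by
  classical
  obtain ⟨_, _⟩ := exists_scalars k R Z
  have : SMulCommClass R k Z := IsScalarTower.to_smulCommClass'
  have := fun s => finite_hom k (R := R) (X := L s) (Y := Z)
  simp only [homDim_eq]
  rw [← Module.finrank_pi_fintype, ← (LinearMap.lsum R L k (M := Z)).finrank_eq]

lemma homDim_prod_left [Module.Finite k R] [Module.Finite R X] [Module.Finite R Y]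
    [Module.Finite R Z] :
    homDim k (R := R) (X × Y) Z = homDim k (R := R) X Z + homDim k (R := R) Y Z := by
  obtain ⟨_, _⟩ := exists_scalars k R Z
  have : SMulCommClass R k Z := IsScalarTower.to_smulCommClass'
  have := finite_hom k (R := R) (X := X) (Y := Z)
  have := finite_hom k (R := R) (X := Y) (Y := Z)
  simp only [homDim_eq]
  rw [← Module.finrank_prod,
    ← (LinearMap.coprodEquiv k (R := R) (M := X) (M₂ := Y) (M₃ := Z)).finrank_eq]

lemma homDim_eq_add_finrank_range [Module.Finite k R] [Module.Finite R X] [Module.Finite R Y]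
    [Module k Y] [IsScalarTower k R Y] [SMulCommClass R k Y] [Module k Z]
    [IsScalarTower k R Z] [SMulCommClass R k Z] (p : Y →ₗ[R] Z) :
    homDim k (R := R) X Y = homDim k (R := R) X (LinearMap.ker p) +
      Module.finrank k (LinearMap.range (postcomp k R X p)) := by
  have : SMulCommClass R k (LinearMap.ker p) := ⟨fun r c x => Subtype.ext (smul_comm r c x.1)⟩
  have := finite_hom k (R := R) (X := X) (Y := Y)
  rw [homDim_eq, homDim_eq, ← LinearMap.finrank_range_add_finrank_ker (postcomp k R X p), add_comm]
  congr 1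
  have hrange : LinearMap.range (postcomp k R X (LinearMap.ker p).subtype) =
      LinearMap.ker (postcomp k R X p) := by
    ext f
    constructor
    · rintro ⟨g, rfl⟩
      ext x
      exact (g x).2
    · intro hf
      exact ⟨f.codRestrict _ fun x => LinearMap.congr_fun hf x, rfl⟩
  rw [← hrange]
  refine LinearMap.finrank_range_of_inj fun f g h => ?_
  ext x
  exact LinearMap.congr_fun h x

lemma homDim_ker_add [Module.Finite k R] [Module.Finite R X] [Module.Finite R Y]
    (p : Y →ₗ[R] Z) (h : ∀ f : X →ₗ[R] Z, ∃ g, p ∘ₗ g = f) :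
    homDim k (R := R) X Y = homDim k (R := R) X (LinearMap.ker p) + homDim k (R := R) X Z := by
  obtain ⟨_, _⟩ := exists_scalars k R Y
  have : SMulCommClass R k Y := IsScalarTower.to_smulCommClass'
  obtain ⟨_, _⟩ := exists_scalars k R Z
  have : SMulCommClass R k Z := IsScalarTower.to_smulCommClass'
  rw [homDim_eq_add_finrank_range k p, LinearMap.range_eq_top (f := postcomp k R X p).mpr h,
    finrank_top, homDim_eq k (Y := Z)]

lemma exists_lift_of_homDim [Module.Finite k R] [Module.Finite R X] [Module.Finite R Y]
    [Module.Finite R Z] (p : Y →ₗ[R] Z)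
    (h : homDim k (R := R) X Y = homDim k (R := R) X (LinearMap.ker p) + homDim k (R := R) X Z)
    (f : X →ₗ[R] Z) : ∃ g, p ∘ₗ g = f := by
  obtain ⟨_, _⟩ := exists_scalars k R Y
  have : SMulCommClass R k Y := IsScalarTower.to_smulCommClass'
  obtain ⟨_, _⟩ := exists_scalars k R Z
  have : SMulCommClass R k Z := IsScalarTower.to_smulCommClass'
  have := finite_hom k (R := R) (X := X) (Y := Z)
  rw [homDim_eq_add_finrank_range k p, add_right_inj, homDim_eq k (Y := Z)] at h
  exact LinearMap.range_eq_top.mp (Submodule.eq_top_of_finrank_eq h) f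

lemma homDim_eq_of_le_range [Module.Finite k R] [Module.Finite R X] [Module.Finite R Y]
    (p : Z →ₗ[R] Y) (hp : Function.Injective p) (h : ∀ f : X →ₗ[R] Y, ∃ g, p ∘ₗ g = f) :
    homDim k (R := R) X Z = homDim k (R := R) X Y := by
  obtain ⟨_, _⟩ := exists_scalars k R Y
  have : SMulCommClass R k Y := IsScalarTower.to_smulCommClass'
  obtain ⟨_, _⟩ := exists_scalars k R Z
  have : SMulCommClass R k Z := IsScalarTower.to_smulCommClass'
  rw [homDim_eq, homDim_eq]
  refine LinearEquiv.finrank_eq (LinearEquiv.ofBijective (postcomp k R X p) ⟨fun f g hfg => ?_, h⟩)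
  ext x
  exact hp (LinearMap.congr_fun hfg x)

lemma homDim_add_of_extendsAlong [Module.Finite k R] [Module.Finite R Y] {M : Type u}
    [AddCommGroup M] [Module R M] (e : ProjPres R M) (h : ExtendsAlong e.d Y) :
    homDim k (R := R) M Y + homDim k (R := R) e.P₁ Y = homDim k (R := R) e.P₀ Y := by
  obtain ⟨_, _⟩ := exists_scalars k R Y
  have : SMulCommClass R k Y := IsScalarTower.to_smulCommClass'
  have := finite_hom k (R := R) (X := e.P₀) (Y := Y)
  simp only [homDim_eq]
  rw [← LinearMap.finrank_range_add_finrank_ker (precomp k R (Z := Y) e.d),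
    LinearMap.range_eq_top (f := precomp k R (Z := Y) e.d).mpr h, finrank_top, add_comm]
  congr 1
  have hrange : LinearMap.range (precomp k R (Z := Y) e.π) =
      LinearMap.ker (precomp k R (Z := Y) e.d) := by
    ext f
    constructor
    · rintro ⟨g, rfl⟩
      ext x
      simp [precomp, e.π_d]
    · intro hf
      have hf' : LinearMap.ker e.π ≤ LinearMap.ker f := fun x hx => by
        obtain ⟨y, rfl⟩ := (e.exact x).mp hx
        exact LinearMap.congr_fun hf y
      refine ⟨(LinearMap.ker e.π).liftQ f hf' ∘ₗ (e.π.quotKerEquivOfSurjective e.surj).symm, ?_⟩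
      ext x
      have : (e.π.quotKerEquivOfSurjective e.surj).symm (e.π x) = Submodule.Quotient.mk x := by
        rw [LinearEquiv.symm_apply_eq]
        rfl
      simp [precomp, this]
  rw [← hrange]
  refine (LinearMap.finrank_range_of_inj fun f g hfg => ?_).symm
  ext x
  obtain ⟨x, rfl⟩ := e.surj x
  exact LinearMap.congr_fun hfg x

include k in
lemma exists_right_approx [Module.Finite k R] [Module.Finite R X] [Module.Finite R W] :
    ∃ (r : ℕ) (u : (Fin r → W) →ₗ[R] X), ∀ g : W →ₗ[R] X, ∃ h, u ∘ₗ h = g := by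
  obtain ⟨_, _⟩ := exists_scalars k R X
  have : SMulCommClass R k X := IsScalarTower.to_smulCommClass'
  obtain ⟨_, _⟩ := exists_scalars k R W
  have : SMulCommClass R k W := IsScalarTower.to_smulCommClass'
  have := finite_hom k (R := R) (X := W) (Y := X)
  obtain ⟨n, s, hs⟩ := Module.Finite.exists_fin (R := k) (M := W →ₗ[R] X)
  refine ⟨n, ∑ i, s i ∘ₗ LinearMap.proj i, fun g => ?_⟩
  obtain ⟨c, rfl⟩ := (Submodule.mem_span_range_iff_exists_fun k).mp (hs ▸ Submodule.mem_top : g ∈ _)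
  refine ⟨LinearMap.pi fun i => c i • LinearMap.id, ?_⟩
  ext x
  simp only [LinearMap.comp_apply, LinearMap.sum_apply, LinearMap.proj_apply, LinearMap.pi_apply,
    LinearMap.smul_apply, LinearMap.id_apply]
  refine Finset.sum_congr rfl fun i _ => ?_
  rw [← algebraMap_smul R, map_smul, algebraMap_smul]

include k in
lemma exists_left_approx [Module.Finite k R] [Module.Finite R X] [Module.Finite R W] :
    ∃ (r : ℕ) (u : X →ₗ[R] (Fin r → W)), ∀ g : X →ₗ[R] W, ∃ h, h ∘ₗ u = g := by
  obtain ⟨_, _⟩ := exists_scalars k R W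
  have : SMulCommClass R k W := IsScalarTower.to_smulCommClass'
  have := finite_hom k (R := R) (X := X) (Y := W)
  obtain ⟨n, s, hs⟩ := Module.Finite.exists_fin (R := k) (M := X →ₗ[R] W)
  refine ⟨n, LinearMap.pi s, fun g => ?_⟩
  obtain ⟨c, rfl⟩ := (Submodule.mem_span_range_iff_exists_fun k).mp (hs ▸ Submodule.mem_top : g ∈ _)
  refine ⟨∑ i, c i • LinearMap.proj i, ?_⟩
  ext x
  simp [LinearMap.sum_apply]

lemma homDim_congr_right (e : Y ≃ₗ[R] Z) : homDim k (R := R) X Y = homDim k (R := R) X Z := by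
  obtain ⟨_, _⟩ := exists_scalars k R Y
  have : SMulCommClass R k Y := IsScalarTower.to_smulCommClass'
  obtain ⟨_, _⟩ := exists_scalars k R Z
  have : SMulCommClass R k Z := IsScalarTower.to_smulCommClass'
  rw [homDim_eq, homDim_eq]
  refine LinearEquiv.finrank_eq (LinearEquiv.ofBijective (postcomp k R X e.toLinearMap)
    ⟨fun f g hfg => ?_, fun f => ⟨e.symm.toLinearMap ∘ₗ f, ?_⟩⟩)
  · ext x
    exact e.injective (LinearMap.congr_fun hfg x)
  · ext x
    simp [postcomp]

/-- An integral combination of the functions `homDim k (Q i)` with the `Q i` projective which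
vanishes on simple modules vanishes. -/
lemma sum_homDim_eq_zero [Module.Finite k R] {ι : Type} [Fintype ι] (Q : ι → ModuleCat.{u} R)
    [∀ i, Module.Projective R (Q i)] [∀ i, Module.Finite R (Q i)] (a : ι → ℤ)
    (h : ∀ (S : Type u) [AddCommGroup S] [Module R S], IsSimpleModule R S →
      ∑ i, a i * (homDim k (R := R) (Q i) S : ℤ) = 0) [Module.Finite R X] :
    ∑ i, a i * (homDim k (R := R) (Q i) X : ℤ) = 0 := by
  have := IsArtinianRing.of_finite k R
  have hX : IsFiniteLength R X :=
    isFiniteLength_iff_isNoetherian_isArtinian.mpr ⟨inferInstance, inferInstance⟩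
  revert hX
  suffices H : ∀ (X : Type u) [AddCommGroup X] [Module R X], IsFiniteLength R X →
      ∑ i, a i * (homDim k (R := R) (Q i) X : ℤ) = 0 from H X
  intro X _ _ hX
  induction hX with
  | @of_subsingleton M _ _ _ =>
    refine Finset.sum_eq_zero fun i _ => ?_
    rw [(homDim_eq_zero_iff k).mpr fun f => by ext; exact Subsingleton.elim _ _]
    simp
  | @of_simple_quotient M _ _ N hN hf ih =>
    have := (isFiniteLength_iff_isNoetherian_isArtinian.mp (hf.of_simple_quotient)).1
    have key : ∀ i, homDim k (R := R) (Q i) M =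
        homDim k (R := R) (Q i) N + homDim k (R := R) (Q i) (M ⧸ N) := fun i => by
      have := homDim_ker_add k (X := Q i) N.mkQ fun f =>
        Module.projective_lifting_property N.mkQ f N.mkQ_surjective
      rwa [Submodule.ker_mkQ] at this
    simp only [key, Nat.cast_add, mul_add, Finset.sum_add_distrib]
    rw [ih, h _ hN, add_zero]

end HomDim

section UpperBound

variable (k : Type u) [Field k] {R : Type u} [Ring R] [Algebra k R] [Module.Finite k R]

/-- If `M'` and `M''` have the same hom dimensions into the modules they generate, then `M''` is a
direct summand of a finite sum of copies of `M'`. -/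
lemma exists_retract_of_homDim_eq (M' M'' : Type u) [AddCommGroup M'] [Module R M']
    [Module.Finite R M'] [AddCommGroup M''] [Module R M''] [Module.Finite R M'']
    (H : ∀ (X : Type u) [AddCommGroup X] [Module R X] [Module.Finite R X],
      IsGenBy R (M' × M'') X → homDim k (R := R) M' X = homDim k (R := R) M'' X) :
    ∃ r, IsRetract R M'' (Fin r → M') := by
  have := IsArtinianRing.of_finite k R
  have H1 : ∀ (X : Type u) [AddCommGroup X] [Module R X] [Module.Finite R X],
      homDim k (R := R) M' X = homDim k (R := R) M'' X := by
    intro X _ _ _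
    obtain ⟨r, u, hu⟩ := exists_right_approx k (R := R) (X := X) (W := M' × M'')
    let T := LinearMap.range u
    have h1 : homDim k (R := R) M' T = homDim k (R := R) M' X :=
      homDim_eq_of_le_range k T.subtype T.injective_subtype fun f => by
        obtain ⟨h, hh⟩ := hu (f ∘ₗ LinearMap.fst R M' M'')
        refine ⟨u.rangeRestrict ∘ₗ h ∘ₗ LinearMap.inl R M' M'', ?_⟩
        ext x
        simpa using LinearMap.congr_fun hh (x, 0)
    have h2 : homDim k (R := R) M'' T = homDim k (R := R) M'' X :=
      homDim_eq_of_le_range k T.subtype T.injective_subtype fun f => by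
        obtain ⟨h, hh⟩ := hu (f ∘ₗ LinearMap.snd R M' M'')
        refine ⟨u.rangeRestrict ∘ₗ h ∘ₗ LinearMap.inr R M' M'', ?_⟩
        ext x
        simpa using LinearMap.congr_fun hh (0, x)
    rw [← h1, ← h2]
    exact H T ⟨r, u.rangeRestrict, u.surjective_rangeRestrict⟩
  obtain ⟨r, p, hp⟩ := exists_right_approx k (R := R) (X := M'') (W := M')
  have h1 : homDim k (R := R) M' (LinearMap.range p) = homDim k (R := R) M' M'' :=
    homDim_eq_of_le_range k (Submodule.subtype _) (Submodule.injective_subtype _) fun f => by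
      obtain ⟨h, rfl⟩ := hp f
      exact ⟨p.rangeRestrict ∘ₗ h, rfl⟩
  have hps : Function.Surjective p := by
    have h0 : homDim k (R := R) M'' (LinearMap.ker (LinearMap.range p).subtype) = 0 := by
      rw [Submodule.ker_subtype, homDim_eq_zero_iff k]
      intro f
      exact LinearMap.ext fun x => Subsingleton.elim _ _
    obtain ⟨g, hg⟩ := exists_lift_of_homDim k (X := M'') (LinearMap.range p).subtype
      (by rw [h0, zero_add, ← H1, ← H1, h1]) LinearMap.id
    intro y
    obtain ⟨x, hx⟩ := (g y).2
    exact ⟨x, hx.trans (LinearMap.congr_fun hg y)⟩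
  have h2 := homDim_ker_add k p hp
  rw [H1, H1, H1] at h2
  obtain ⟨s, hs⟩ := exists_lift_of_homDim k p h2 LinearMap.id
  exact ⟨r, s, p, hs⟩

lemma IsGenBy.of_fintype {M X : Type u} [AddCommGroup M] [Module R M] [AddCommGroup X] [Module R X]
    {κ : Type} [Fintype κ] (u : (κ → M) →ₗ[R] X) (hu : Function.Surjective u) :
    IsGenBy R M X :=
  ⟨Fintype.card κ, u ∘ₗ LinearMap.funLeft R M (Fintype.equivFin κ), by
    rw [LinearMap.coe_comp]
    exact hu.comp (LinearMap.funLeft_surjective_of_injective _ _ _ (Fintype.equivFin κ).injective)⟩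

lemma not_pos_of_sum_homDim_eq_zero {ι : Type} [Fintype ι] (L : ι → ModuleCat.{u} R)
    [∀ i, Module.Finite R (L i)] (hL : ∀ i, IsIndecModule R (L i))
    (hinj : ∀ i i', Nonempty (L i ≃ₗ[R] L i') → i = i') (a : ι → ℤ)
    (h : ∀ (X : Type u) [AddCommGroup X] [Module R X] [Module.Finite R X],
      IsGenBy R (∀ i, L i) X → ∑ i, a i * (homDim k (R := R) (L i) X : ℤ) = 0) (i : ι) :
    ¬ 0 < a i := by
  classical
  intro hi
  have := IsArtinianRing.of_finite k R
  let S' := Σ i, Fin (a i).toNat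
  let S'' := Σ i, Fin (-a i).toNat
  have hgen : IsGenBy R (∀ i, L i) ((∀ s : S', L s.1) × (∀ s : S'', L s.1)) := by
    refine IsGenBy.of_fintype (κ := S' ⊕ S'') (LinearMap.prod
      (LinearMap.pi fun s => LinearMap.proj s.1 ∘ₗ LinearMap.proj (Sum.inl s))
      (LinearMap.pi fun s => LinearMap.proj s.1 ∘ₗ LinearMap.proj (Sum.inr s))) fun x => ?_
    refine ⟨Sum.elim (fun s => Pi.single s.1 (x.1 s)) (fun s => Pi.single s.1 (x.2 s)), ?_⟩
    ext s <;> simp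
  have hdim : ∀ (b : ι → ℤ) (X : Type u) [AddCommGroup X] [Module R X] [Module.Finite R X],
      (homDim k (R := R) (∀ s : Σ i, Fin (b i).toNat, L s.1) X : ℤ) =
        ∑ i, ((b i).toNat : ℤ) * (homDim k (R := R) (L i) X : ℤ) := by
    intro b X _ _ _
    rw [homDim_pi_left k (fun s : Σ i, Fin (b i).toNat => (L s.1 : Type u)), Fintype.sum_sigma]
    push_cast
    refine Finset.sum_congr rfl fun i _ => ?_
    exact (Finset.sum_const (homDim k (R := R) (L i) X : ℤ)).trans (by simp)
  obtain ⟨r, hr⟩ := exists_retract_of_homDim_eq k (∀ s : S'', L s.1) (∀ s : S', L s.1) (by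
    intro X _ _ _ hX
    have hX' : IsGenBy R ((∀ s : S', L s.1) × (∀ s : S'', L s.1)) X :=
      (IsGenBy.of_surjective (LinearEquiv.prodComm R _ _).toLinearMap
        (LinearEquiv.prodComm R _ _).surjective).trans hX
    have h1 := h X (hgen.trans hX')
    have h2 := hdim a X
    have h3 := hdim (fun i => -a i) X
    have h4 : ∑ i, a i * (homDim k (R := R) (L i) X : ℤ) =
        ∑ i, ((a i).toNat : ℤ) * (homDim k (R := R) (L i) X : ℤ) -
        ∑ i, ((-a i).toNat : ℤ) * (homDim k (R := R) (L i) X : ℤ) := by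
      rw [← Finset.sum_sub_distrib]
      refine Finset.sum_congr rfl fun i _ => ?_
      rw [← sub_mul]
      congr 1
      omega
    rw [h1, ← h2, ← h3] at h4
    have : (homDim k (R := R) (∀ s : S', L s.1) X : ℤ) = homDim k (R := R) (∀ s : S'', L s.1) X :=
      (sub_eq_zero.mp h4.symm)
    exact_mod_cast this.symm)
  have h1 : IsRetract R (L i) (∀ s : S', L s.1) :=
    IsRetract.of_pi (R := R) (fun s : S' => (L s.1 : Type u)) ⟨i, ⟨0, by omega⟩⟩
  obtain ⟨_, h2⟩ := (hL i).exists_retract_of_pi (fun _ : Fin r => ∀ s : S'', L s.1) (h1.trans hr)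
  obtain ⟨⟨i', t⟩, h3⟩ := (hL i).exists_equiv_of_pi (fun s : S'' => (L s.1 : Type u))
    (fun s => hL s.1) h2
  obtain rfl := hinj _ _ h3
  have := t.2
  omega

lemma eq_zero_of_sum_homDim_eq_zero {ι : Type} [Fintype ι] (L : ι → ModuleCat.{u} R)
    [∀ i, Module.Finite R (L i)] (hL : ∀ i, IsIndecModule R (L i))
    (hinj : ∀ i i', Nonempty (L i ≃ₗ[R] L i') → i = i') (a : ι → ℤ)
    (h : ∀ (X : Type u) [AddCommGroup X] [Module R X] [Module.Finite R X],
      IsGenBy R (∀ i, L i) X → ∑ i, a i * (homDim k (R := R) (L i) X : ℤ) = 0) (i : ι) :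
    a i = 0 := by
  have h1 := not_pos_of_sum_homDim_eq_zero k L hL hinj a h i
  have h2 := not_pos_of_sum_homDim_eq_zero k L hL hinj (fun i => -a i) (fun X _ _ _ hX => by
    simp [h X hX]) i
  omega

include k in
lemma card_add_card_le {ι κ σ : Type} [Fintype ι] [Fintype κ] [Fintype σ]
    (L : ι → ModuleCat.{u} R) [∀ i, Module.Finite R (L i)] (hL : ∀ i, IsIndecModule R (L i))
    (hinj : ∀ i i', Nonempty (L i ≃ₗ[R] L i') → i = i') (e : ∀ i, ProjPres R (L i))
    (he : ∀ i i', ExtendsAlong (e i).d (L i')) (P : κ → ModuleCat.{u} R)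
    [∀ j, Module.Finite R (P j)] [∀ j, Module.Projective R (P j)]
    (hP : ∀ j, IsIndecModule R (P j)) (hPinj : ∀ j j', Nonempty (P j ≃ₗ[R] P j') → j = j')
    (hPL : ∀ j i (f : P j →ₗ[R] L i), f = 0) (S : σ → ModuleCat.{u} R)
    (hS : ∀ (T : Type u) [AddCommGroup T] [Module R T], IsSimpleModule R T →
      ∃ s, Nonempty (T ≃ₗ[R] S s)) :
    Fintype.card ι + Fintype.card κ ≤ Fintype.card σ := by
  rw [← Fintype.card_sum]
  let χ (X : Type u) [AddCommGroup X] [Module R X] : (ι ⊕ κ) → ℤ :=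
    Sum.elim (fun i => (homDim k (R := R) (e i).P₀ X : ℤ) - homDim k (R := R) (e i).P₁ X)
      fun j => homDim k (R := R) (P j) X
  let Φ : ((ι ⊕ κ) → ℤ) →ₗ[ℤ] (σ → ℤ) :=
    LinearMap.pi fun s => ∑ t, χ (S s) t • LinearMap.proj t
  refine card_le_of_injective ℤ Φ ((injective_iff_map_eq_zero Φ).mpr fun v hv => ?_)
  have hv' : ∀ (X : Type u) [AddCommGroup X] [Module R X] [Module.Finite R X],
      ∑ i, v (.inl i) * ((homDim k (R := R) (e i).P₀ X : ℤ) - homDim k (R := R) (e i).P₁ X) +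
        ∑ j, v (.inr j) * (homDim k (R := R) (P j) X : ℤ) = 0 := by
    intro X _ _ _
    let Q : ι ⊕ ι ⊕ κ → ModuleCat.{u} R := Sum.elim (fun i => ModuleCat.of R (e i).P₀)
      (Sum.elim (fun i => ModuleCat.of R (e i).P₁) P)
    have hQ : ∀ t, Module.Projective R (Q t) := by
      rintro (i | i | j)
      · exact (e i).projective₀
      · exact (e i).projective₁
      · exact inferInstanceAs (Module.Projective R (P j))
    have hQ' : ∀ t, Module.Finite R (Q t) := by
      rintro (i | i | j)
      · exact (e i).finite₀
      · exact (e i).finite₁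
      · exact inferInstanceAs (Module.Finite R (P j))
    have := sum_homDim_eq_zero k (X := X) Q (Sum.elim (fun i => v (.inl i))
      (Sum.elim (fun i => -v (.inl i)) fun j => v (.inr j))) (by
        intro T _ _ hT
        obtain ⟨s, ⟨f⟩⟩ := hS T hT
        have := congrFun hv s
        simp only [homDim_congr_right k f]
        simp only [Φ, χ, LinearMap.pi_apply, LinearMap.add_apply, LinearMap.sum_apply,
          LinearMap.smul_apply,
          LinearMap.proj_apply, Fintype.sum_sum_type, Sum.elim_inl, Sum.elim_inr, smul_eq_mul,
          sub_mul, Finset.sum_sub_distrib, Pi.zero_apply] at this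
        simp only [Fintype.sum_sum_type, Sum.elim_inl, Sum.elim_inr, neg_mul, Q,
          Finset.sum_neg_distrib]
        rw [← this]
        simp only [mul_comm]
        abel)
    simp only [Fintype.sum_sum_type, Sum.elim_inl, Sum.elim_inr, neg_mul, Q,
      Finset.sum_neg_distrib] at this
    rw [← this]
    simp only [mul_sub, Finset.sum_sub_distrib]
    abel
  have ha : ∀ i, v (.inl i) = 0 := by
    refine eq_zero_of_sum_homDim_eq_zero k L hL hinj _ fun X _ _ _ hX => ?_
    have h1 := hv' X
    rw [Finset.sum_eq_zero (s := Finset.univ) (f := fun j => v (.inr j) * _) fun j _ => ?_,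
      add_zero] at h1
    · rw [← h1]
      refine Finset.sum_congr rfl fun i _ => ?_
      rw [← homDim_add_of_extendsAlong k (e i)
        ((ExtendsAlong.pi (L := fun i => (L i : Type u)) (he i)).of_isGenBy hX)]
      push_cast
      ring
    · rw [(homDim_eq_zero_iff k).mpr (hom_eq_zero_of_isGenBy (fun f => ?_) hX)]
      · simp
      · ext x i
        exact LinearMap.congr_fun (hPL j i (LinearMap.proj i ∘ₗ f)) x
  have hb : ∀ j, v (.inr j) = 0 := by
    refine eq_zero_of_sum_homDim_eq_zero k P hP hPinj _ fun X _ _ _ _ => ?_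
    have h1 := hv' X
    simpa [ha] using h1
  ext (i | j)
  · exact ha i
  · exact hb j

end UpperBound

section Simples

variable {R : Type u} [Ring R] {P Q S T : Type u} [AddCommGroup P] [Module R P]
  [AddCommGroup Q] [Module R Q] [AddCommGroup S] [Module R S] [AddCommGroup T] [Module R T]

lemma isCoatom_ker_of_ne_zero [IsSimpleModule R S] (f : P →ₗ[R] S) (hf : f ≠ 0) :
    IsCoatom (LinearMap.ker f) := by
  rw [← isSimpleModule_iff_isCoatom]
  exact IsSimpleModule.congr (f.quotKerEquivOfSurjective (LinearMap.surjective_of_ne_zero hf))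

lemma IsProjCover.ne_zero [IsSimpleModule R S] {π : P →ₗ[R] S} (h : IsProjCover R π) : π ≠ 0 := by
  rintro rfl
  have := IsSimpleModule.nontrivial R S
  obtain ⟨x, hx⟩ := exists_ne (0 : S)
  obtain ⟨y, rfl⟩ := h.2.1 x
  exact hx rfl

lemma IsProjCover.le_ker [IsSimpleModule R S] {π : P →ₗ[R] S} (h : IsProjCover R π)
    {U : Submodule R P} (hU : U ≠ ⊤) : U ≤ LinearMap.ker π := by
  by_contra hle
  refine hU (h.2.2 U ?_)
  rw [sup_comm]
  exact (isCoatom_ker_of_ne_zero π h.ne_zero).2 _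
    (lt_of_le_of_ne le_sup_left fun he => hle (he ▸ le_sup_right))

lemma IsProjCover.isIndecModule [IsSimpleModule R S] {π : P →ₗ[R] S} (h : IsProjCover R π) :
    IsIndecModule R P := by
  have := IsSimpleModule.nontrivial R S
  refine ⟨h.2.1.nontrivial, fun U V hUV => ?_⟩
  by_cases hU : U = ⊤
  · subst hU
    exact .inr (by simpa using hUV.inf_eq_bot)
  by_cases hV : V = ⊤
  · subst hV
    exact .inl (by simpa using hUV.inf_eq_bot)
  exact absurd (top_le_iff.mp (hUV.sup_eq_top ▸ sup_le (h.le_ker hU) (h.le_ker hV)))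
    (isCoatom_ker_of_ne_zero π h.ne_zero).1

lemma IsProjCover.nonempty_equiv [IsSimpleModule R S] [IsSimpleModule R T] {π : P →ₗ[R] S}
    (h : IsProjCover R π) (f : P →ₗ[R] T) (hf : f ≠ 0) : Nonempty (T ≃ₗ[R] S) := by
  have h1 := isCoatom_ker_of_ne_zero f hf
  have h2 := h.le_ker h1.1
  have h3 : LinearMap.ker f = LinearMap.ker π :=
    ((h1.le_iff.mp h2).resolve_left (isCoatom_ker_of_ne_zero π h.ne_zero).1).symm
  exact ⟨(f.quotKerEquivOfSurjective (LinearMap.surjective_of_ne_zero hf)).symm.trans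
    ((Submodule.quotEquivOfEq _ _ h3).trans (π.quotKerEquivOfSurjective h.2.1))⟩

lemma IsProjCover.isRetract [IsSimpleModule R S] {π : P →ₗ[R] S} (h : IsProjCover R π)
    [Module.Projective R Q] (f : Q →ₗ[R] S) (hf : f ≠ 0) : IsRetract R P Q := by
  obtain ⟨g, hg⟩ := Module.projective_lifting_property π f h.2.1
  have hgs : LinearMap.range g = ⊤ := by
    refine h.2.2 _ (eq_top_iff.mpr fun x _ => ?_)
    obtain ⟨y, hy⟩ := LinearMap.surjective_of_ne_zero hf (π x)
    rw [← add_sub_cancel (g y) x]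
    refine Submodule.add_mem_sup ⟨y, rfl⟩ ?_
    rw [LinearMap.mem_ker, map_sub, ← hy, ← hg]
    simp
  have := h.1
  obtain ⟨s, hs⟩ := Module.projective_lifting_property g LinearMap.id
    (LinearMap.range_eq_top.mp hgs)
  exact ⟨s, g, hs⟩

/-- Representatives of the isomorphism classes of simple modules. -/
lemma exists_simple_reps (R : Type u) [Ring R] [IsArtinianRing R] :
    ∃ S : Fin (numSimples R) → ModuleCat.{u} R, (∀ s, IsSimpleModule R (S s)) ∧
      (∀ s t, Nonempty (S s ≃ₗ[R] S t) → s = t) ∧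
      ∀ (T : Type u) [AddCommGroup T] [Module R T], IsSimpleModule R T →
        ∃ s, Nonempty (T ≃ₗ[R] S s) := by
  classical
  obtain ⟨n, L, hL, ⟨e⟩⟩ := hasIndecDecomp (R := R) R
  have hret : ∀ a, IsRetract R (L a) R := fun a =>
    (IsRetract.of_pi (R := R) (fun s => (L s : Type u)) a).trans (.of_equiv e.symm)
  let ι := {a : Fin n // ∃ T : ModuleCat.{u} R, IsSimpleModule R T ∧ ∃ f : L a →ₗ[R] T, f ≠ 0}
  choose F hF f hf using fun a : ι => a.2
  obtain ⟨g, hg1, hg2⟩ := exists_fin_reps _ (equivalence_linearEquiv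
    (fun X : {X : ModuleCat.{u} R // IsSimpleModule R X} => X.1)) (fun a => ⟨F a, hF a⟩) (by
      rintro ⟨T, hT⟩
      obtain ⟨P, π, hfin, hπ⟩ := exists_projCover (R := R) T
      have := IsSimpleModule.nontrivial R T
      obtain ⟨t, ht⟩ := exists_ne (0 : T)
      let u : (∀ s, L s) →ₗ[R] T := LinearMap.toSpanSingleton R T t ∘ₗ e.symm.toLinearMap
      have hu : u ≠ 0 := fun h0 => ht (by simpa [u] using LinearMap.congr_fun h0 (e 1))
      obtain ⟨a, ha⟩ : ∃ a, u ∘ₗ LinearMap.single R (fun s => (L s : Type u)) a ≠ 0 := by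
        by_contra! hall
        exact hu (LinearMap.pi_ext' hall)
      have : Module.Projective R (L a) := (hret a).projective
      have := hπ.isIndecModule.1
      obtain ⟨w⟩ := (hL a).equiv_of_retract (hπ.isRetract _ ha)
      let a' : ι := ⟨a, T, hT, _, ha⟩
      have := hF a'
      have hc : f a' ∘ₗ w.toLinearMap ≠ 0 := fun h0 => hf a' (by
        ext x
        simpa using LinearMap.congr_fun h0 (w.symm x))
      obtain ⟨v⟩ := hπ.nonempty_equiv _ hc
      exact ⟨a', ⟨v.symm⟩⟩)
  exact ⟨fun s => (g s).1, fun s => (g s).2, hg1, fun T _ _ hT => hg2 ⟨ModuleCat.of R T, hT⟩⟩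

end Simples

section LowerBound

variable {R : Type u} [Ring R]

lemma projective_pi {ι : Type} [Fintype ι] (P : ι → Type u) [∀ i, AddCommGroup (P i)]
    [∀ i, Module R (P i)] [∀ i, Module.Projective R (P i)] : Module.Projective R (∀ i, P i) := by
  classical
  exact Module.Projective.of_equiv (DFinsupp.linearEquivFunOnFintype (R := R) (M := P))

namespace ProjPres

variable {M N X Y : Type u} [AddCommGroup M] [Module R M] [AddCommGroup N] [Module R N]
  [AddCommGroup X] [Module R X] [AddCommGroup Y] [Module R Y]

/-- The product of finitely many presentations. -/
def pi {ι : Type} [Fintype ι] {L : ι → Type u} [∀ i, AddCommGroup (L i)] [∀ i, Module R (L i)]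
    (e : ∀ i, ProjPres R (L i)) : ProjPres R (∀ i, L i) :=
  have := projective_pi (R := R) fun i => (e i).P₀
  have := projective_pi (R := R) fun i => (e i).P₁
  { P₀ := ∀ i, (e i).P₀
    P₁ := ∀ i, (e i).P₁
    d := LinearMap.pi fun i => (e i).d ∘ₗ LinearMap.proj i
    π := LinearMap.pi fun i => (e i).π ∘ₗ LinearMap.proj i
    exact := fun x => ⟨fun hx => by
      choose y hy using fun i => ((e i).exact (x i)).mp (congrFun hx i)
      exact ⟨y, funext hy⟩, by
      rintro ⟨y, rfl⟩
      exact funext fun i => (e i).π_d (y i)⟩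
    surj := fun x => by
      choose y hy using fun i => (e i).surj (x i)
      exact ⟨y, funext hy⟩ }

lemma extendsAlong_pi {ι : Type} [Fintype ι] {L : ι → Type u} [∀ i, AddCommGroup (L i)]
    [∀ i, Module R (L i)] (e : ∀ i, ProjPres R (L i)) (h : ∀ i, ExtendsAlong (e i).d X) :
    ExtendsAlong (pi e).d X := by
  classical
  intro f
  choose g hg using fun i => h i (f ∘ₗ LinearMap.single R (fun i => (e i).P₁) i)
  refine ⟨LinearMap.lsum R (fun i => (e i).P₀) ℕ g, LinearMap.pi_ext' fun i => ?_⟩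
  ext x
  refine Eq.trans ?_ (LinearMap.congr_fun (hg i) x)
  change (LinearMap.lsum R (fun i => (e i).P₀) ℕ g)
    (fun j => (e j).d (Pi.single (M := fun i => (e i).P₁) i x j)) = g i ((e i).d x)
  rw [LinearMap.lsum_apply, LinearMap.sum_apply, Finset.sum_eq_single i]
  · simp
  · intro j _ hj
    simp [Pi.single_eq_of_ne hj]
  · simp

/-- Transport of a presentation along an isomorphism. -/
def congr (e : ProjPres R M) (f : M ≃ₗ[R] N) : ProjPres R N :=
  { P₀ := e.P₀
    P₁ := e.P₁
    d := e.d
    π := f.toLinearMap ∘ₗ e.π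
    exact := fun x => by
      rw [← e.exact x]
      simp
    surj := f.surjective.comp e.surj }

lemma exists_desc (e : ProjPres R M) (f : e.P₀ →ₗ[R] X) (hf : ∀ x, f (e.d x) = 0) :
    ∃ g : M →ₗ[R] X, ∀ x, g (e.π x) = f x := by
  have hf' : LinearMap.ker e.π ≤ LinearMap.ker f := fun x hx => by
    obtain ⟨y, rfl⟩ := (e.exact x).mp hx
    exact hf y
  refine ⟨(LinearMap.ker e.π).liftQ f hf' ∘ₗ (e.π.quotKerEquivOfSurjective e.surj).symm, ?_⟩
  intro x
  have : (e.π.quotKerEquivOfSurjective e.surj).symm (e.π x) = Submodule.Quotient.mk x := by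
    rw [LinearEquiv.symm_apply_eq]
    rfl
  simp [this]

lemma exists_section (c : ProjPres R M) (p : Y →ₗ[R] M) (hp : Function.Surjective p)
    (h : ExtendsAlong c.d (LinearMap.ker p)) : ∃ s, p ∘ₗ s = LinearMap.id := by
  obtain ⟨l, hl⟩ := Module.projective_lifting_property p c.π hp
  have hl' : ∀ x, p (l x) = c.π x := LinearMap.congr_fun hl
  obtain ⟨g, hg⟩ := h ((l ∘ₗ c.d).codRestrict _ fun x => by simp [hl', c.π_d])
  have hg' : ∀ x, (g (c.d x) : Y) = l (c.d x) := fun x =>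
    congrArg Subtype.val (LinearMap.congr_fun hg x)
  obtain ⟨s, hs⟩ := c.exists_desc (l - (LinearMap.ker p).subtype ∘ₗ g) fun x => by simp [hg']
  refine ⟨s, ?_⟩
  ext x
  obtain ⟨x, rfl⟩ := c.surj x
  simp [hs, hl']

lemma extendsAlong_ker (e : ProjPres R N) (p : Y →ₗ[R] X) (h : ExtendsAlong e.d Y)
    (hp : ∀ g : N →ₗ[R] X, ∃ g', p ∘ₗ g' = g) : ExtendsAlong e.d (LinearMap.ker p) := by
  intro f
  obtain ⟨l, hl⟩ := h ((LinearMap.ker p).subtype ∘ₗ f)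
  have hl' : ∀ x, l (e.d x) = f x := LinearMap.congr_fun hl
  obtain ⟨g, hg⟩ := e.exists_desc (p ∘ₗ l) fun x => by simp [hl']
  obtain ⟨g', rfl⟩ := hp g
  refine ⟨(l - g' ∘ₗ e.π).codRestrict _ fun x => ?_, ?_⟩
  · have := hg x
    simp only [LinearMap.comp_apply] at this
    simp [this]
  · ext x
    simp [hl', e.π_d]

end ProjPres

variable (k : Type u) [Field k] [Algebra k R] [Module.Finite k R]

section

variable {N : Type u} [AddCommGroup N] [Module R N] [Module.Finite R N]

include k in
lemma exists_surjective_right_approx {X : Type u} [AddCommGroup X] [Module R X]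
    [Module.Finite R X] (h : IsGenBy R N X) : ∃ (r : ℕ) (p : (Fin r → N) →ₗ[R] X),
      Function.Surjective p ∧ ∀ g : N →ₗ[R] X, ∃ g', p ∘ₗ g' = g := by
  classical
  obtain ⟨r, p, hp⟩ := exists_right_approx k (R := R) (X := X) (W := N)
  obtain ⟨r', u, hu⟩ := h
  refine ⟨r, p, ?_, hp⟩
  choose g hg using fun i => hp (u ∘ₗ LinearMap.single R (fun _ : Fin r' => N) i)
  have : u = p ∘ₗ LinearMap.lsum R (fun _ => N) ℕ g := by
    refine LinearMap.pi_ext' fun i => ?_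
    rw [← hg i]
    ext x
    simp only [LinearMap.comp_apply, LinearMap.lsum_apply, LinearMap.sum_apply,
      LinearMap.proj_apply]
    rw [Finset.sum_eq_single i]
    · simp
    · intro j _ hj
      simp [Pi.single_eq_of_ne hj]
    · simp
  rw [this, LinearMap.coe_comp] at hu
  exact hu.of_comp

include k in
/-- A projective module `Q` has a left approximation by `N` whose cokernel lies in `add N`. -/
lemma exists_coapprox (e : ProjPres R N) (h : ExtendsAlong e.d N)
    (hgen : ∀ (X : Type u) [AddCommGroup X] [Module R X] [Module.Finite R X],
      ExtendsAlong e.d X → IsGenBy R N X) (Q : Type u) [AddCommGroup Q] [Module R Q]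
    [Module.Projective R Q] [Module.Finite R Q] :
    ∃ (C : ModuleCat.{u} R) (c : ProjPres R C) (s r : ℕ), Nonempty (c.P₀ ≃ₗ[R] (Fin s → e.P₀)) ∧
      Nonempty (c.P₁ ≃ₗ[R] (Fin s → e.P₁) × Q) ∧ ExtendsAlong c.d N ∧
      IsRetract R C (Fin r → N) := by
  classical
  have := IsArtinianRing.of_finite k R
  obtain ⟨s, f, hf⟩ := exists_left_approx k (R := R) (X := Q) (W := N)
  let E := ProjPres.pi fun _ : Fin s => e
  obtain ⟨f', hf'⟩ := Module.projective_lifting_property E.π f E.surj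
  have hf'' : ∀ x, E.π (f' x) = f x := LinearMap.congr_fun hf'
  let c : ProjPres R ((Fin s → N) ⧸ LinearMap.range f) :=
    { P₀ := E.P₀
      P₁ := E.P₁ × Q
      d := E.d.coprod f'
      π := (LinearMap.range f).mkQ ∘ₗ E.π
      exact := fun x => ⟨fun hx => by
        obtain ⟨q, hq⟩ := (Submodule.Quotient.mk_eq_zero _).mp hx
        obtain ⟨y, hy⟩ := (E.exact (x - f' q)).mp (by rw [map_sub, hf'', hq, sub_self])
        exact ⟨(y, q), by simp [hy]⟩, by
        rintro ⟨⟨y, q⟩, rfl⟩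
        simp [E.π_d, hf'']⟩
      surj := (Submodule.mkQ_surjective _).comp E.surj }
  have hE : ExtendsAlong E.d N := ProjPres.extendsAlong_pi _ fun _ => h
  have hc : ExtendsAlong c.d N := by
    intro φ
    obtain ⟨g, hg⟩ := hE (φ ∘ₗ LinearMap.inl R E.P₁ Q)
    obtain ⟨g', hg'⟩ := hf (φ ∘ₗ LinearMap.inr R E.P₁ Q - g ∘ₗ f')
    refine ⟨g + g' ∘ₗ E.π, ?_⟩
    refine LinearMap.prod_ext ?_ ?_
    · rw [← hg]
      ext1 x
      simp [c, E.π_d]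
    · ext x
      have := LinearMap.congr_fun hg' x
      simp only [LinearMap.comp_apply, LinearMap.sub_apply] at this
      simp [c, hf'', this]
  have hCgen : IsGenBy R N ((Fin s → N) ⧸ LinearMap.range f) :=
    ⟨s, _, Submodule.mkQ_surjective _⟩
  obtain ⟨r, p, hp, hp'⟩ := exists_surjective_right_approx k hCgen
  have hker : IsGenBy R N (LinearMap.ker p) := hgen _ <|
    e.extendsAlong_ker p (ExtendsAlong.pi (L := fun _ : Fin r => N) fun _ => h) hp'
  obtain ⟨σ, hσ⟩ := c.exists_section p hp (hc.of_isGenBy hker)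
  exact ⟨ModuleCat.of R _, c, s, r, ⟨.refl _ _⟩, ⟨.refl _ _⟩, hc, σ, p, hσ⟩

end

end LowerBound

section Euler

variable (k : Type u) [Field k] {R : Type u} [Ring R] [Algebra k R]

/-- The Euler form of a two-term complex of projectives with a module. -/
noncomputable def ProjPres.euler {C : Type u} [AddCommGroup C] [Module R C] (c : ProjPres R C)
    (S : Type u) [AddCommGroup S] [Module R S] : ℤ :=
  (homDim k (R := R) c.P₀ S : ℤ) - homDim k (R := R) c.P₁ S

variable [Module.Finite k R] {C N P S : Type u} [AddCommGroup C] [Module R C]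
  [AddCommGroup N] [Module R N] [AddCommGroup P] [Module R P] [AddCommGroup S] [Module R S]
  [IsSimpleModule R S]

lemma ProjPres.IsMin.euler_eq {e : ProjPres R C} (he : e.IsMin) (c : ProjPres R C)
    (h : ExtendsAlong c.d N) {π : P →ₗ[R] S} (hπ : IsProjCover R π) {f : P →ₗ[R] N}
    (hf : f ≠ 0) : c.euler k S = e.euler k S := by
  have := IsArtinianRing.of_finite k R
  obtain ⟨E, K, _, _, ⟨e₀⟩, ⟨e₁⟩, hK⟩ := he.exists_equiv_prod c
  have hE : Module.Finite R E := Module.Finite.of_surjective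
    (LinearMap.snd R e.P₀ E ∘ₗ e₀.toLinearMap) (Prod.snd_surjective.comp e₀.surjective)
  have hKS : homDim k (R := R) K S = 0 := by
    rw [homDim_eq_zero_iff]
    intro g
    by_contra hg
    exact hf ((hπ.isRetract g hg).hom_eq_zero (hK N h) f)
  rw [ProjPres.euler, ProjPres.euler, homDim_congr_left k e₀, homDim_congr_left k e₁,
    homDim_prod_left, homDim_prod_left, homDim_prod_left, hKS]
  push_cast
  ring

lemma exists_euler_eq_sum [Module.Finite R N] {ι : Type} [Fintype ι] (L : ι → ModuleCat.{u} R)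
    (hL : ∀ (Y : Type u) [AddCommGroup Y] [Module R Y], IsIndecModule R Y → IsRetract R Y N →
      ∃ s, Nonempty (Y ≃ₗ[R] L s)) (e : ∀ i, ProjPres R (L i))
    (he : ∀ i, ExtendsAlong (e i).d N) (c : ProjPres R C) (hc : ExtendsAlong c.d N) (r : ℕ)
    (hC : IsRetract R C (Fin r → N)) : ∃ b : ι → ℤ, ∀ (P S : Type u) [AddCommGroup P] [Module R P]
      [AddCommGroup S] [Module R S] [IsSimpleModule R S] (π : P →ₗ[R] S), IsProjCover R π →
        ∀ f : P →ₗ[R] N, f ≠ 0 → c.euler k S = ∑ i, b i * (e i).euler k S := by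
  classical
  have := IsArtinianRing.of_finite k R
  have := hC.finite
  obtain ⟨n, Y, hY, ⟨g⟩⟩ := hasIndecDecomp (R := R) C
  have hYC : ∀ t, IsRetract R (Y t) C := fun t =>
    (IsRetract.of_pi (R := R) (fun t => (Y t : Type u)) t).trans (.of_equiv g.symm)
  have hYN : ∀ t, ∃ s, Nonempty (Y t ≃ₗ[R] L s) := fun t => by
    have := (hYC t).finite
    obtain ⟨-, h⟩ := (hY t).exists_retract_of_pi (fun _ : Fin r => N) ((hYC t).trans hC)
    exact hL _ (hY t) h
  choose i hi using hYN
  let φ : (∀ t, L (i t)) ≃ₗ[R] C := (LinearEquiv.piCongrRight fun t => (hi t).some).symm ≪≫ₗ g.symm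
  let c' : ProjPres R C := (ProjPres.pi fun t => e (i t)).congr φ
  have hc' : ExtendsAlong c'.d N := ProjPres.extendsAlong_pi _ fun t => he (i t)
  obtain ⟨m, hm⟩ := ProjPres.exists_isMin (R := R) C
  refine ⟨fun s => ∑ t, if i t = s then 1 else 0, ?_⟩
  intro P S _ _ _ _ _ π hπ f hf
  rw [hm.euler_eq k c hc hπ hf, ← hm.euler_eq k c' hc' hπ hf]
  have h : c'.euler k S = ∑ t, (e (i t)).euler k S := by
    simp only [ProjPres.euler, Finset.sum_sub_distrib, ← Nat.cast_sum]
    rw [← homDim_pi_left, ← homDim_pi_left]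
    rfl
  rw [h]
  simp only [Finset.sum_mul]
  rw [Finset.sum_comm]
  simp

end Euler

section Support

variable (k : Type u) [Field k] {R : Type u} [Ring R] [Algebra k R] [Module.Finite k R]
variable {N : Type u} [AddCommGroup N] [Module R N] [Module.Finite R N]

include k in
lemma exists_simple_covers (R : Type u) [Ring R] [Algebra k R] [Module.Finite k R] :
    ∃ (S P : Fin (numSimples R) → ModuleCat.{u} R) (π : ∀ s, P s →ₗ[R] S s),
      (∀ s, IsSimpleModule R (S s)) ∧ (∀ s t, Nonempty (S s ≃ₗ[R] S t) → s = t) ∧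
      (∀ (T : Type u) [AddCommGroup T] [Module R T], IsSimpleModule R T →
        ∃ s, Nonempty (T ≃ₗ[R] S s)) ∧
      (∀ s, Module.Finite R (P s)) ∧ (∀ s, IsProjCover R (π s)) := by
  have := IsArtinianRing.of_finite k R
  obtain ⟨S, hS, hSinj, hSex⟩ := exists_simple_reps R
  choose P π hP hπ using fun s => exists_projCover (R := R) (S s)
  exact ⟨S, P, π, hS, hSinj, hSex, hP, hπ⟩

include k in
/-- A module that is Ext-projective in and generates the torsion class of modules along which a
presentation of it extends is completed by a projective module to a support τ-tilting pair. -/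
lemma exists_support_of_gen (e : ProjPres R N) (h : ExtendsAlong e.d N)
    (hgen : ∀ (X : Type u) [AddCommGroup X] [Module R X] [Module.Finite R X],
      ExtendsAlong e.d X → IsGenBy R N X) :
    ∃ Q : ModuleCat.{u} R, Module.Projective R Q ∧ Module.Finite R Q ∧
      (∀ f : (Q : Type u) →ₗ[R] N, f = 0) ∧
      numIndec R N + numIndec R (Q : Type u) = numSimples R := by
  classical
  have := IsArtinianRing.of_finite k R
  obtain ⟨S, P, π, hS, hSinj, hSex, hP, hπ⟩ := exists_simple_covers k R
  have hPproj : ∀ s, Module.Projective R (P s) := fun s => (hπ s).1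
  obtain ⟨L, hL, hLN, hLinj, hLex⟩ := exists_indec_reps (R := R) N
  have hLfin : ∀ i, Module.Finite R (L i) := fun i => (hLN i).finite
  choose l hlmin using fun i => ProjPres.exists_isMin (R := R) (L i)
  have hl : ∀ i, ExtendsAlong (l i).d N := fun i => (hlmin i).extendsAlong e (hLN i) h
  have hPinj : ∀ s t, Nonempty (P s ≃ₗ[R] P t) → s = t := by
    rintro s t ⟨g⟩
    refine hSinj s t ((hπ t).nonempty_equiv (π s ∘ₗ g.symm.toLinearMap) fun h0 => ?_)
    refine (hπ s).ne_zero (LinearMap.ext fun x => ?_)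
    simpa using LinearMap.congr_fun h0 (g x)
  let p : Fin (numSimples R) → Prop := fun s => ∀ f : P s →ₗ[R] N, f = 0
  let J := {s // p s}
  let I := {s // ¬ p s}
  have hJ : numIndec R (∀ j : J, P j) = Fintype.card J :=
    numIndec_eq_card (fun j : J => P j) (fun j => (hπ j).isIndecModule)
      (fun s t hst => Subtype.ext (hPinj _ _ hst)) (.refl _ _)
  have hJN : ∀ f : (∀ j : J, P j) →ₗ[R] N, f = 0 := by
    intro f
    refine LinearMap.pi_ext' fun j => ?_
    rw [j.2 (f ∘ₗ LinearMap.single R (fun j : J => (P j : Type u)) j), LinearMap.zero_comp]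
  have hle : Fintype.card (Fin (numIndec R N)) + Fintype.card J ≤
      Fintype.card (Fin (numSimples R)) :=
    card_add_card_le k L hL hLinj l (fun i i' => (hl i).of_isRetract (hLN i'))
      (fun j : J => P j) (fun j => (hπ j).isIndecModule)
      (fun s t hst => Subtype.ext (hPinj _ _ hst))
      (fun j i f => by
        obtain ⟨a, b, hab⟩ := hLN i
        have := j.2 (a ∘ₗ f)
        rw [← LinearMap.id_comp f, ← hab, LinearMap.comp_assoc, this, LinearMap.comp_zero]) S hSex
  have hge : Fintype.card I ≤ numIndec R N := by
    let Ψ : (I → ℤ) →ₗ[ℤ] (Fin (numIndec R N) → ℤ) :=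
      LinearMap.pi fun i => ∑ s : I, (l i).euler k (S s) • LinearMap.proj s
    have hΨ : ∀ v i, Ψ v i = ∑ s : I, (l i).euler k (S s) * v s := fun v i => by simp [Ψ]
    have hinj : Function.Injective Ψ := by
      rw [injective_iff_map_eq_zero]
      intro v hv
      funext s₀
      obtain ⟨C, c, m, r, ⟨e₀⟩, ⟨e₁⟩, hcN, hC⟩ := exists_coapprox k e h hgen (P s₀)
      obtain ⟨b, hb⟩ := exists_euler_eq_sum k L hLex l hl c hcN r hC
      obtain ⟨b', hb'⟩ := exists_euler_eq_sum k L hLex l hl e h 1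
        (.of_equiv (LinearEquiv.funUnique (Fin 1) R N).symm)
      have key : ∀ s : I, (homDim k (R := R) (P s₀) (S s) : ℤ) =
          ∑ i, (m * b' i - b i) * (l i).euler k (S s) := by
        intro s
        obtain ⟨f, hf⟩ := not_forall.mp s.2
        have h1 := hb _ _ (π s) (hπ s) f hf
        have h2 := hb' _ _ (π s) (hπ s) f hf
        simp only [sub_mul, Finset.sum_sub_distrib, mul_assoc, ← Finset.mul_sum]
        rw [← h1, ← h2, ProjPres.euler, ProjPres.euler, homDim_congr_left k e₀,
          homDim_congr_left k e₁, homDim_prod_left, homDim_pi_left, homDim_pi_left]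
        simp
        ring
      have hsum : ∑ s : I, (homDim k (R := R) (P s₀) (S s) : ℤ) * v s = 0 := by
        simp only [key, Finset.sum_mul]
        rw [Finset.sum_comm]
        refine Finset.sum_eq_zero fun i _ => ?_
        simp only [mul_assoc, ← Finset.mul_sum]
        rw [← hΨ, hv]
        simp
      rw [Finset.sum_eq_single s₀] at hsum
      · refine (mul_eq_zero.mp hsum).resolve_left fun h0 => ?_
        rw [Nat.cast_eq_zero, homDim_eq_zero_iff] at h0
        exact (hπ s₀).ne_zero (h0 _)
      · intro s _ hs
        have : homDim k (R := R) (P s₀) (S s) = 0 := by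
          rw [homDim_eq_zero_iff]
          intro f
          by_contra hf
          exact hs (Subtype.ext (hSinj _ _ ((hπ s₀).nonempty_equiv f hf)))
        simp [this]
      · simp
    simpa using card_le_of_injective ℤ Ψ hinj
  have hIJ : Fintype.card I = numSimples R - Fintype.card J := by
    rw [Fintype.card_subtype_compl p, Fintype.card_fin]
  refine ⟨ModuleCat.of R (∀ j : J, P j), projective_pi fun j : J => (P j : Type u),
    inferInstanceAs (Module.Finite R (∀ j : J, P j)), hJN, ?_⟩
  change _ + numIndec R (∀ j : J, P j) = _
  simp only [Fintype.card_fin] at hle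
  omega

end Support

section Bongartz

variable (k : Type u) [Field k] {R : Type u} [Ring R] [Algebra k R] [Module.Finite k R]
variable {M X Q : Type u} [AddCommGroup M] [Module R M] [Module.Finite R M]
  [AddCommGroup X] [Module R X] [AddCommGroup Q] [Module R Q]

omit [Algebra k R] [Module.Finite k R] [Module.Finite R M] in
lemma extendsAlong_comp_fst_iff {Q₀ Q₁ : Type u} [AddCommGroup Q₀] [Module R Q₀]
    [AddCommGroup Q₁] [Module R Q₁] (d : Q₁ →ₗ[R] Q₀) :
    ExtendsAlong (d ∘ₗ LinearMap.fst R Q₁ Q) X ↔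
      ExtendsAlong d X ∧ ∀ f : Q →ₗ[R] X, f = 0 := by
  constructor
  · refine fun h => ⟨fun f => ?_, fun f => ?_⟩
    · obtain ⟨g, hg⟩ := h (f ∘ₗ LinearMap.fst R Q₁ Q)
      refine ⟨g, LinearMap.ext fun x => ?_⟩
      simpa using LinearMap.congr_fun hg (x, 0)
    · obtain ⟨g, hg⟩ := h (f ∘ₗ LinearMap.snd R Q₁ Q)
      refine LinearMap.ext fun x => ?_
      simpa using (LinearMap.congr_fun hg (0, x)).symm
  · rintro ⟨h, h0⟩ f
    obtain ⟨g, hg⟩ := h (f ∘ₗ LinearMap.inl R Q₁ Q)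
    refine ⟨g, LinearMap.prod_ext (LinearMap.ext fun x => ?_) ?_⟩
    · simpa using LinearMap.congr_fun hg x
    · rw [h0 (f ∘ₗ LinearMap.inr R Q₁ Q)]
      ext x
      simp

omit [Module.Finite R M] in
include k in
/-- The Bongartz completion of a two-term presilting complex. -/
lemma exists_bongartz [Module.Finite R Q] [Module.Projective R Q] (e : ProjPres R M)
    (h : ExtendsAlong e.d M) (hQ : ∀ f : Q →ₗ[R] M, f = 0) :
    ∃ (E : ModuleCat.{u} R) (c : ProjPres R E), Module.Finite R E ∧ ExtendsAlong e.d E ∧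
      (∀ f : Q →ₗ[R] E, f = 0) ∧ ∀ (X : Type u) [AddCommGroup X] [Module R X],
        ExtendsAlong e.d X → (∀ f : Q →ₗ[R] X, f = 0) →
          ExtendsAlong c.d X ∧ (Module.Finite R X → IsGenBy R E X) := by
  classical
  let d : e.P₁ × Q →ₗ[R] e.P₀ := e.d ∘ₗ LinearMap.fst R e.P₁ Q
  have hdM : ExtendsAlong d M := (extendsAlong_comp_fst_iff e.d).mpr ⟨h, hQ⟩
  have := finite_hom k (R := R) (X := e.P₁ × Q) (Y := R)
  obtain ⟨r, s, hs⟩ := Module.Finite.exists_fin (R := k) (M := (e.P₁ × Q →ₗ[R] R))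
  let D : (Fin r → e.P₁ × Q) →ₗ[R] (Fin r → e.P₀) × R :=
    (LinearMap.pi fun i => d ∘ₗ LinearMap.proj i).prod (∑ i, s i ∘ₗ LinearMap.proj i)
  have := projective_pi (R := R) fun _ : Fin r => e.P₁ × Q
  have := projective_pi (R := R) fun _ : Fin r => e.P₀
  let c : ProjPres R (((Fin r → e.P₀) × R) ⧸ LinearMap.range D) :=
    { P₀ := (Fin r → e.P₀) × R
      P₁ := Fin r → e.P₁ × Q
      d := D
      π := (LinearMap.range D).mkQ
      exact := fun x => by simp
      surj := Submodule.mkQ_surjective _ }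
  let q : ((Fin r → e.P₀) × R) →ₗ[R] ((Fin r → e.P₀) × R) ⧸ LinearMap.range D := Submodule.mkQ _
  have hq : Function.Surjective q := Submodule.mkQ_surjective _
  have hcD : ∀ x, q (D x) = 0 := fun x => by simp [q]
  have hcX : ∀ (X : Type u) [AddCommGroup X] [Module R X], ExtendsAlong d X →
      ExtendsAlong c.d X := by
    intro X _ _ hX f
    choose g hg using fun i => hX (f ∘ₗ LinearMap.single R (fun _ => e.P₁ × Q) i)
    refine ⟨(LinearMap.lsum R (fun _ => e.P₀) ℕ g) ∘ₗ LinearMap.fst R _ R, ?_⟩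
    refine LinearMap.pi_ext' fun i => LinearMap.ext fun x => ?_
    refine Eq.trans ?_ (LinearMap.congr_fun (hg i) x)
    change (LinearMap.lsum R (fun _ => e.P₀) ℕ g) (fun j => d (Pi.single (M := fun _ => e.P₁ × Q)
      i x j)) = g i (d x)
    rw [LinearMap.lsum_apply, LinearMap.sum_apply, Finset.sum_eq_single i]
    · simp
    · intro j _ hj
      simp [Pi.single_eq_of_ne hj]
    · simp
  have hD : ∀ i x, D (Pi.single i x) = (Pi.single i (d x), s i x) := by
    intro i x
    refine Prod.ext (funext fun j => ?_) ?_
    · by_cases hj : j = i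
      · subst hj; simp [D]
      · simp [D, Pi.single_eq_of_ne hj]
    · change (∑ j, s j ∘ₗ LinearMap.proj j) (Pi.single i x) = s i x
      rw [LinearMap.sum_apply, Finset.sum_eq_single i]
      · simp
      · intro j _ hj
        simp [Pi.single_eq_of_ne hj]
      · simp
  have hdE : ExtendsAlong d (((Fin r → e.P₀) × R) ⧸ LinearMap.range D) := by
    obtain ⟨_, _⟩ := exists_scalars k R (((Fin r → e.P₀) × R) ⧸ LinearMap.range D)
    have hinr : ∀ g : e.P₁ × Q →ₗ[R] R, ∃ w : e.P₀ →ₗ[R] ((Fin r → e.P₀) × R) ⧸ LinearMap.range D,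
        ∀ x, w (d x) = q (0, g x) := by
      intro g
      have hg : g ∈ Submodule.span k (Set.range s) := hs ▸ Submodule.mem_top
      induction hg using Submodule.span_induction with
      | mem g hg =>
        obtain ⟨i, rfl⟩ := hg
        refine ⟨-(q ∘ₗ LinearMap.inl R _ R ∘ₗ LinearMap.single R (fun _ => e.P₀) i), fun x => ?_⟩
        rw [eq_comm, ← sub_eq_zero]
        have := hcD (Pi.single i x)
        rw [hD] at this
        simpa [← map_add, LinearMap.inl_apply] using this
      | zero => exact ⟨0, fun x => (map_zero q).symm⟩
      | add g₁ g₂ _ _ h₁ h₂ =>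
        obtain ⟨w₁, h₁⟩ := h₁
        obtain ⟨w₂, h₂⟩ := h₂
        exact ⟨w₁ + w₂, fun x => by simp [h₁, h₂, ← map_add]⟩
      | smul a g _ h₁ =>
        obtain ⟨w₁, h₁⟩ := h₁
        refine ⟨a • w₁, fun x => ?_⟩
        have : ((0, (a • g) x) : (Fin r → e.P₀) × R) = algebraMap k R a • (0, g x) := by
          simp [Algebra.smul_def]
        rw [LinearMap.smul_apply, h₁, this, map_smul, algebraMap_smul]
    intro f
    obtain ⟨l, hl⟩ := Module.projective_lifting_property q f hq
    have hl' : ∀ x, q (l x) = f x := LinearMap.congr_fun hl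
    have hsilt : ∀ a : e.P₁ × Q →ₗ[R] e.P₀, ∃ (w : e.P₀ →ₗ[R] e.P₀)
        (v : e.P₁ × Q →ₗ[R] e.P₁ × Q), ∀ x, a x = w (d x) + d (v x) := by
      intro a
      obtain ⟨g, hg⟩ := hdM (e.π ∘ₗ a)
      obtain ⟨w, hw⟩ := Module.projective_lifting_property e.π g e.surj
      have hw' : ∀ x, e.π (w x) = g x := LinearMap.congr_fun hw
      have hg' : ∀ x, g (d x) = e.π (a x) := LinearMap.congr_fun hg
      let a' : e.P₁ × Q →ₗ[R] LinearMap.ker e.π := (a - w ∘ₗ d).codRestrict _ fun x => by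
        simp [hw', hg']
      let d' : e.P₁ × Q →ₗ[R] LinearMap.ker e.π := d.codRestrict _ fun x => e.π_d x.1
      have hd' : Function.Surjective d' := by
        rintro ⟨y, hy⟩
        obtain ⟨x, hx⟩ := (e.exact y).mp hy
        exact ⟨(x, 0), Subtype.ext hx⟩
      obtain ⟨v, hv⟩ := Module.projective_lifting_property d' a' hd'
      refine ⟨w, v, fun x => ?_⟩
      have h1 : d (v x) = a x - w (d x) := congrArg Subtype.val (LinearMap.congr_fun hv x)
      rw [h1, add_sub_cancel]
    choose w v hwv using fun i => hsilt (LinearMap.proj i ∘ₗ LinearMap.fst R _ R ∘ₗ l)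
    obtain ⟨w', hw'⟩ := hinr (LinearMap.snd R _ R ∘ₗ l -
      LinearMap.snd R _ R ∘ₗ D ∘ₗ LinearMap.pi v)
    refine ⟨q ∘ₗ LinearMap.inl R _ R ∘ₗ LinearMap.pi w + w', LinearMap.ext fun x => ?_⟩
    rw [← hl', ← sub_zero (q (l x)), ← hcD (LinearMap.pi v x), ← map_sub]
    simp only [LinearMap.comp_apply, LinearMap.add_apply, hw', ← map_add]
    congr 1
    refine Prod.ext (funext fun i => ?_) ?_
    · have := hwv i x
      simp only [LinearMap.comp_apply, LinearMap.proj_apply, LinearMap.fst_apply] at this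
      simp [D, this]
    · simp
  obtain ⟨h1, h2⟩ := (extendsAlong_comp_fst_iff e.d).mp hdE
  refine ⟨ModuleCat.of R _, c, inferInstanceAs (Module.Finite R (_ ⧸ _)), h1, h2, ?_⟩
  intro X _ _ hX hQX
  have hdX : ExtendsAlong d X := (extendsAlong_comp_fst_iff e.d).mpr ⟨hX, hQX⟩
  refine ⟨hcX X hdX, fun hfin => ?_⟩
  obtain ⟨n, u, hu⟩ := Module.Finite.exists_fin' R X
  have hw : ∀ j : Fin n, ∃ w : ((Fin r → e.P₀) × R) ⧸ LinearMap.range D →ₗ[R] X,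
      ∀ a, w (q (0, a)) = u (Pi.single j a) := by
    intro j
    choose g hg using fun i => hdX (-(u ∘ₗ LinearMap.single R (fun _ => R) j ∘ₗ s i))
    let F := (LinearMap.lsum R (fun _ => e.P₀) ℕ g).coprod
      (u ∘ₗ LinearMap.single R (fun _ => R) j)
    have hF : F ∘ₗ D = 0 := by
      refine LinearMap.pi_ext' fun i => LinearMap.ext fun x => ?_
      have hgi : g i (d x) = -u (Pi.single j (s i x)) := LinearMap.congr_fun (hg i) x
      simp only [F, LinearMap.comp_apply, LinearMap.single_apply, hD, LinearMap.coprod_apply]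
      rw [LinearMap.lsum_apply, LinearMap.sum_apply, Finset.sum_eq_single i]
      · simp [hgi]
      · intro j _ hj
        simp [Pi.single_eq_of_ne hj]
      · simp
    refine ⟨(LinearMap.range D).liftQ F (LinearMap.range_le_ker_iff.mpr hF), fun a => ?_⟩
    simp [q, F]
  choose w hw using hw
  refine ⟨n, LinearMap.lsum R (fun _ => _) ℕ w, fun x => ?_⟩
  obtain ⟨y, rfl⟩ := hu x
  refine ⟨fun j => q (0, y j), ?_⟩
  rw [LinearMap.lsum_apply, LinearMap.sum_apply]
  simp only [LinearMap.comp_apply, LinearMap.proj_apply, hw]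
  rw [← map_sum, Finset.univ_sum_single]

include k in
/-- Over a finite dimensional algebra the modules right perpendicular to a support τ-tilting pair
are generated by its module part. -/
lemma isGenBy_of_extendsAlong [Module.Finite R Q] [Module.Projective R Q] (e : ProjPres R M)
    (h : ExtendsAlong e.d M) (hQ : ∀ f : Q →ₗ[R] M, f = 0)
    (hcard : numIndec R M + numIndec R Q = numSimples R) [Module.Finite R X]
    (hX : ExtendsAlong e.d X) (hQX : ∀ f : Q →ₗ[R] X, f = 0) : IsGenBy R M X := by
  classical
  have := IsArtinianRing.of_finite k R
  obtain ⟨E, c, _, heE, hQE, hE⟩ := exists_bongartz k e h hQ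
  refine IsGenBy.trans ?_ ((hE X hX hQX).2 ‹_›)
  have hcM : ExtendsAlong c.d M := (hE M h hQ).1
  have hcE : ExtendsAlong c.d E := (hE E heE hQE).1
  obtain ⟨S, -, -, -, -, hS, -⟩ := exists_simple_covers k R
  obtain ⟨L, hL, hLM, hLinj, -⟩ := exists_indec_reps (R := R) M
  obtain ⟨P, hP, hPQ, hPinj, -⟩ := exists_indec_reps (R := R) Q
  have hLfin : ∀ i, Module.Finite R (L i) := fun i => (hLM i).finite
  have hPfin : ∀ i, Module.Finite R (P i) := fun i => (hPQ i).finite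
  have hPproj : ∀ i, Module.Projective R (P i) := fun i => (hPQ i).projective
  choose l hl using fun i => ProjPres.exists_isMin (R := R) (L i)
  have hYL : ∀ (Y : ModuleCat.{u} R), IsIndecModule R Y → IsRetract R Y E →
      ∃ i, Nonempty (Y ≃ₗ[R] L i) := by
    intro Y hY hYE
    by_contra! hYL
    have := hYE.finite
    obtain ⟨y, hy⟩ := ProjPres.exists_isMin (R := R) Y
    let L' : Option (Fin (numIndec R M)) → ModuleCat.{u} R := fun o => o.elim Y L
    have hfin : ∀ o, Module.Finite R (L' o) := by
      rintro (_ | i)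
      · assumption
      · exact hLfin i
    let l' : ∀ o, ProjPres R (L' o) := fun o => match o with
      | none => y
      | some i => l i
    have hl' : ∀ (Z : Type u) [AddCommGroup Z] [Module R Z], ExtendsAlong e.d Z →
        ExtendsAlong c.d Z → ∀ o, ExtendsAlong (l' o).d Z := by
      rintro Z _ _ h1 h2 (_ | i)
      · exact hy.extendsAlong c hYE h2
      · exact (hl i).extendsAlong e (hLM i) h1
    have hPM : ∀ j, ∀ f : P j →ₗ[R] M, f = 0 := fun j f => (hPQ j).hom_eq_zero hQ f
    have hPE : ∀ j, ∀ f : P j →ₗ[R] E, f = 0 := fun j f => (hPQ j).hom_eq_zero hQE f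
    have hret : ∀ {Z W : Type u} [AddCommGroup Z] [Module R Z] [AddCommGroup W] [Module R W] (j),
        IsRetract R Z W → (∀ f : P j →ₗ[R] W, f = 0) → ∀ f : P j →ₗ[R] Z, f = 0 := by
      rintro Z W _ _ _ _ j ⟨a, b, hab⟩ h0 f
      rw [← LinearMap.id_comp f, ← hab, LinearMap.comp_assoc, h0 (a ∘ₗ f), LinearMap.comp_zero]
    have := card_add_card_le k L'
      (by
        rintro (_ | i)
        · exact hY
        · exact hL i)
      (by
        rintro (_ | i) (_ | i') ⟨f⟩
        · rfl
        · exact ((hYL i').false f).elim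
        · exact ((hYL i).false f.symm).elim
        · exact congrArg some (hLinj i i' ⟨f⟩))
      l'
      (by
        rintro o (_ | i)
        · exact (hl' E heE hcE o).of_isRetract hYE
        · exact (hl' M h hcM o).of_isRetract (hLM i))
      P hP hPinj
      (by
        rintro j (_ | i)
        · exact hret j hYE (hPE j)
        · exact hret j (hLM i) (hPM j)) S hS
    simp only [Fintype.card_option, Fintype.card_fin] at this
    omega
  obtain ⟨n, Y, hY, ⟨g⟩⟩ := hasIndecDecomp (R := R) E
  have hYM : ∀ t, IsRetract R (Y t) M := fun t => by
    obtain ⟨i, ⟨f⟩⟩ := hYL (Y t) (hY t)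
      ((IsRetract.of_pi (R := R) (fun t => (Y t : Type u)) t).trans (.of_equiv g.symm))
    exact (IsRetract.of_equiv f).trans (hLM i)
  choose a b hab using hYM
  refine ⟨n, g.symm.toLinearMap ∘ₗ LinearMap.pi fun t => b t ∘ₗ LinearMap.proj t, ?_⟩
  rw [LinearMap.coe_comp]
  exact g.symm.surjective.comp fun y =>
    ⟨fun t => a t (y t), funext fun t => LinearMap.congr_fun (hab t) (y t)⟩

end Bongartz

section Duality

open MonoidAlgebra

variable {k : Type u} [Field k] {H : Type u} [Group H] [Fintype H]

section Trace

variable {P Q X : Type u} [AddCommGroup P] [Module k P] [Module (MonoidAlgebra k H) P]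
  [IsScalarTower k (MonoidAlgebra k H) P] [AddCommGroup Q] [Module k Q]
  [Module (MonoidAlgebra k H) Q] [IsScalarTower k (MonoidAlgebra k H) Q] [AddCommGroup X]
  [Module k X] [Module (MonoidAlgebra k H) X] [IsScalarTower k (MonoidAlgebra k H) X]

/-- Higman's criterion: the identity of a projective module is a trace. -/
lemma exists_sumOfConjugates_eq_id [Module.Projective (MonoidAlgebra k H) P] :
    ∃ θ : P →ₗ[k] P, θ.sumOfConjugates H = LinearMap.id := by
  classical
  obtain ⟨s, hs⟩ := Module.projective_def'.mp ‹Module.Projective (MonoidAlgebra k H) P›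
  let c : MonoidAlgebra k H →ₗ[k] k :=
    { toFun := fun r => r.coeff 1
      map_add' := fun _ _ => rfl
      map_smul' := fun _ _ => rfl }
  have hc : ∀ (x : H) (r : MonoidAlgebra k H), c (single x (1 : k) * r) = r.coeff x⁻¹ := by
    intro x r
    change (single x (1 : k) * r).coeff 1 = _
    simp
  let L : (P →₀ MonoidAlgebra k H) →ₗ[k] P :=
    Finsupp.lsum k fun q => LinearMap.toSpanSingleton k P q ∘ₗ c
  have hL : ∀ w : P →₀ MonoidAlgebra k H,
      ∑ x : H, single x⁻¹ (1 : k) • L (single x (1 : k) • w) =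
        Finsupp.linearCombination (MonoidAlgebra k H) id w := by
    intro w
    induction w using Finsupp.induction_linear with
    | zero => simp
    | add f g hf hg => simp only [smul_add, map_add, Finset.sum_add_distrib, hf, hg]
    | single q r =>
      have h1 : ∀ x : H, L (single x (1 : k) • Finsupp.single q r) = r.coeff x⁻¹ • q := by
        intro x
        rw [Finsupp.smul_single, smul_eq_mul, Finsupp.lsum_single, LinearMap.comp_apply, hc,
          LinearMap.toSpanSingleton_apply]
      simp only [h1, Finsupp.linearCombination_single, id]
      have h2 : r = ∑ x : H, r.coeff x • single x (1 : k) := by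
        refine MonoidAlgebra.ext (Finsupp.ext fun y => ?_)
        rw [coeff_sum, Finset.sum_apply']
        simp [Finsupp.single_apply]
      conv_rhs => rw [h2, Finset.sum_smul]
      refine Fintype.sum_equiv (Equiv.inv H) _ _ fun x => ?_
      rw [smul_comm, smul_assoc]
      rfl
  refine ⟨L ∘ₗ s.restrictScalars k, LinearMap.ext fun v => ?_⟩
  simp only [LinearMap.sumOfConjugates_apply, LinearMap.conjugate_apply, LinearMap.comp_apply,
    LinearMap.restrictScalars_apply, map_smul]
  rw [hL]
  exact LinearMap.congr_fun hs v

lemma trace_comp_sumOfConjugates [Module.Finite k P] (g : X →ₗ[MonoidAlgebra k H] P) (u : P →ₗ[k] X)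
    (θ : P →ₗ[k] P) (hθ : θ.sumOfConjugates H = LinearMap.id) :
    LinearMap.trace k P (g.restrictScalars k ∘ₗ u.sumOfConjugates H ∘ₗ θ) =
      LinearMap.trace k P (g.restrictScalars k ∘ₗ u) := by
  have h1 : g.restrictScalars k ∘ₗ u.sumOfConjugates H ∘ₗ θ =
      ∑ x : H, GroupSMul.linearMap k P x⁻¹ ∘ₗ ((g.restrictScalars k ∘ₗ u) ∘ₗ
        GroupSMul.linearMap k P x ∘ₗ θ) := by
    ext v
    simp [LinearMap.sumOfConjugates_apply, LinearMap.conjugate_apply]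
  have h2 : g.restrictScalars k ∘ₗ u = ∑ x : H, ((g.restrictScalars k ∘ₗ u) ∘ₗ
        GroupSMul.linearMap k P x ∘ₗ θ) ∘ₗ GroupSMul.linearMap k P x⁻¹ := by
    conv_lhs => rw [← LinearMap.comp_id (_ ∘ₗ u), ← hθ]
    ext v
    simp only [LinearMap.comp_apply, LinearMap.sumOfConjugates_apply, LinearMap.conjugate_apply,
      map_sum, LinearMap.sum_apply, GroupSMul.linearMap_apply]
    exact Fintype.sum_equiv (Equiv.inv H) _ _ fun x => by simp
  rw [h1]
  conv_rhs => rw [h2]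
  rw [map_sum, map_sum]
  exact Finset.sum_congr rfl fun x _ => LinearMap.trace_comp_comm' _ _

lemma trace_comp_comm_of_sumOfConjugates [Module.Finite k P] [Module.Finite k Q]
    (a : P →ₗ[MonoidAlgebra k H] Q)
    (b : Q →ₗ[MonoidAlgebra k H] P) (θ : P →ₗ[k] P) (hθ : θ.sumOfConjugates H = LinearMap.id)
    (η : Q →ₗ[k] Q) (hη : η.sumOfConjugates H = LinearMap.id) :
    LinearMap.trace k Q (a.restrictScalars k ∘ₗ b.restrictScalars k ∘ₗ η) =
      LinearMap.trace k P (b.restrictScalars k ∘ₗ a.restrictScalars k ∘ₗ θ) := by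
  have : b.restrictScalars k = (θ ∘ₗ b.restrictScalars k).sumOfConjugates H := by
    ext v
    have := LinearMap.congr_fun hθ (b v)
    simp only [LinearMap.sumOfConjugates_apply, LinearMap.conjugate_apply] at this ⊢
    simpa using this.symm
  conv_lhs => rw [this]
  rw [trace_comp_sumOfConjugates _ _ _ hη, ← LinearMap.comp_assoc, LinearMap.trace_comp_comm']

lemma eq_zero_of_trace_comp [Module.Finite k P] (g : X →ₗ[k] P)
    (h : ∀ u : P →ₗ[k] X, LinearMap.trace k P (g ∘ₗ u) = 0) : g = 0 := by
  ext x
  rw [LinearMap.zero_apply, ← Module.forall_dual_apply_eq_zero_iff k]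
  intro φ
  have := h (φ.smulRight x)
  rwa [show g ∘ₗ φ.smulRight x = φ.smulRight (g x) from LinearMap.ext fun _ => by simp,
    LinearMap.trace_smulRight] at this

lemma sumOfConjugates_conjugate (u : P →ₗ[k] X) (y : H) :
    (u.conjugate y).sumOfConjugates H = u.sumOfConjugates H := by
  ext v
  simp only [LinearMap.sumOfConjugates_apply]
  refine Fintype.sum_equiv (Equiv.mulLeft y) _ _ fun x => ?_
  simp [LinearMap.conjugate_apply, smul_smul, single_mul_single]

lemma sumOfConjugates_comp_of_equivariant (f : P →ₗ[MonoidAlgebra k H] X) (θ : P →ₗ[k] P)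
    (hθ : θ.sumOfConjugates H = LinearMap.id) :
    (f.restrictScalars k ∘ₗ θ).sumOfConjugates H = f.restrictScalars k := by
  ext v
  have := congrArg f (LinearMap.congr_fun hθ v)
  simp only [LinearMap.sumOfConjugates_apply, LinearMap.conjugate_apply, map_sum, map_smul]
    at this ⊢
  simpa using this

variable [Module.Projective (MonoidAlgebra k H) P] [Module.Finite k P]
  [Module.Projective (MonoidAlgebra k H) Q] [Module.Finite k Q]

lemma ExtendsAlong.eq_zero_of_scalars {d : P →ₗ[MonoidAlgebra k H] Q} (h : ExtendsAlong d X)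
    (g : X →ₗ[MonoidAlgebra k H] P) (hg : d ∘ₗ g = 0) : g = 0 := by
  obtain ⟨θ, hθ⟩ := exists_sumOfConjugates_eq_id (k := k) (H := H) (P := P)
  obtain ⟨η, hη⟩ := exists_sumOfConjugates_eq_id (k := k) (H := H) (P := Q)
  have : g.restrictScalars k = 0 := by
    refine eq_zero_of_trace_comp _ fun u => ?_
    obtain ⟨f, hf⟩ := h (u.sumOfConjugatesEquivariant H)
    have h1 : u.sumOfConjugates H = f.restrictScalars k ∘ₗ d.restrictScalars k := by
      ext v
      exact (LinearMap.congr_fun hf v).symm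
    have h2 := trace_comp_comm_of_sumOfConjugates d (g ∘ₗ f) θ hθ η hη
    have h3 : d.restrictScalars k ∘ₗ (g ∘ₗ f).restrictScalars k = 0 := by
      ext v
      exact LinearMap.congr_fun hg (f v)
    rw [← trace_comp_sumOfConjugates g u θ hθ, h1]
    rw [← LinearMap.comp_assoc, h3, LinearMap.zero_comp, map_zero] at h2
    exact h2.symm
  ext v
  exact LinearMap.congr_fun this v

lemma exists_trace_comp_eq [Module.Finite k X] (μ : Module.Dual k (P →ₗ[k] X)) :
    ∃ w : X →ₗ[k] P, ∀ u, LinearMap.trace k P (w ∘ₗ u) = μ u := by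
  let B : (X →ₗ[k] P) →ₗ[k] Module.Dual k (P →ₗ[k] X) :=
    LinearMap.mk₂ k (fun w u => LinearMap.trace k P (w ∘ₗ u))
      (fun _ _ _ => by rw [LinearMap.add_comp, map_add])
      (fun _ _ _ => by rw [LinearMap.smul_comp, map_smul])
      (fun _ _ _ => by rw [LinearMap.comp_add, map_add])
      (fun _ _ _ => by rw [LinearMap.comp_smul, map_smul])
  have hB : Function.Injective B := (injective_iff_map_eq_zero B).mpr fun w hw =>
    eq_zero_of_trace_comp w fun u => LinearMap.congr_fun hw u
  have hr : Module.finrank k (X →ₗ[k] P) = Module.finrank k (Module.Dual k (P →ₗ[k] X)) := by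
    rw [Subspace.dual_finrank_eq, Module.finrank_linearMap, Module.finrank_linearMap, mul_comm]
  obtain ⟨w, hw⟩ := (LinearMap.injective_iff_surjective_of_finrank_eq_finrank hr).mp hB μ
  exact ⟨w, fun u => LinearMap.congr_fun hw u⟩

lemma extendsAlong_of_eq_zero_of_scalars [Module.Finite k X] {d : P →ₗ[MonoidAlgebra k H] Q}
    (h : ∀ g : X →ₗ[MonoidAlgebra k H] P, d ∘ₗ g = 0 → g = 0) : ExtendsAlong d X := by
  obtain ⟨θ, hθ⟩ := exists_sumOfConjugates_eq_id (k := k) (H := H) (P := P)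
  obtain ⟨η, hη⟩ := exists_sumOfConjugates_eq_id (k := k) (H := H) (P := Q)
  intro f
  by_contra hf
  let W : Submodule k (P →ₗ[k] X) :=
    { carrier := {u | ∃ l : Q →ₗ[MonoidAlgebra k H] X, (l ∘ₗ d).restrictScalars k = u}
      add_mem' := by
        rintro _ _ ⟨l, rfl⟩ ⟨l', rfl⟩
        exact ⟨l + l', rfl⟩
      zero_mem' := ⟨0, rfl⟩
      smul_mem' := by
        rintro c _ ⟨l, rfl⟩
        exact ⟨c • l, rfl⟩ }
  have hfW : f.restrictScalars k ∉ W := by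
    rintro ⟨l, hl⟩
    exact hf ⟨l, LinearMap.ext fun v => LinearMap.congr_fun hl v⟩
  obtain ⟨ξ, hξf, hξW⟩ := W.exists_le_ker_of_notMem hfW
  let μ : Module.Dual k (P →ₗ[k] X) :=
    { toFun := fun u => ξ (u.sumOfConjugates H)
      map_add' := fun u v => by
        rw [← map_add]
        congr 1
        ext x
        simp [LinearMap.sumOfConjugates_apply, LinearMap.conjugate_apply, Finset.sum_add_distrib]
      map_smul' := fun c u => by
        rw [RingHom.id_apply, ← map_smul]
        congr 1
        ext x
        simp [LinearMap.sumOfConjugates_apply, LinearMap.conjugate_apply, Finset.smul_sum,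
          smul_comm c] }
  obtain ⟨w, hw⟩ := exists_trace_comp_eq μ
  have hwc : ∀ y : H, w.conjugate y = w := by
    intro y
    rw [← sub_eq_zero]
    refine eq_zero_of_trace_comp _ fun u => ?_
    have h1 : w.conjugate y ∘ₗ u = GroupSMul.linearMap k P y⁻¹ ∘ₗ
        (w ∘ₗ GroupSMul.linearMap k X y ∘ₗ u) := rfl
    have h2 : (w ∘ₗ GroupSMul.linearMap k X y ∘ₗ u) ∘ₗ GroupSMul.linearMap k P y⁻¹ =
        w ∘ₗ u.conjugate y⁻¹ := by
      ext v
      simp [LinearMap.conjugate_apply]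
    rw [LinearMap.sub_comp, map_sub, h1, LinearMap.trace_comp_comm', h2, hw, hw, sub_eq_zero]
    change ξ _ = ξ _
    rw [sumOfConjugates_conjugate]
  let g : X →ₗ[MonoidAlgebra k H] P := MonoidAlgebra.equivariantOfLinearOfComm w fun y v => by
    have := congrArg (fun q => single y (1 : k) • q) (LinearMap.congr_fun (hwc y) v)
    simpa [LinearMap.conjugate_apply, smul_smul, single_mul_single, ← one_def] using this
  have hgw : g.restrictScalars k = w := LinearMap.ext fun _ => rfl
  have hdg : d ∘ₗ g = 0 := by
    have : (d ∘ₗ g).restrictScalars k = 0 := by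
      refine eq_zero_of_trace_comp _ fun u => ?_
      rw [← trace_comp_sumOfConjugates (d ∘ₗ g) u η hη]
      let l := u.sumOfConjugatesEquivariant H
      have h2 := trace_comp_comm_of_sumOfConjugates d (g ∘ₗ l) θ hθ η hη
      change LinearMap.trace k Q (d.restrictScalars k ∘ₗ (g ∘ₗ l).restrictScalars k ∘ₗ η) = 0
      rw [h2]
      have h3 : (g ∘ₗ l).restrictScalars k ∘ₗ d.restrictScalars k ∘ₗ θ =
        w ∘ₗ ((l ∘ₗ d).restrictScalars k ∘ₗ θ) := rfl
      rw [h3, hw]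
      change ξ _ = 0
      rw [sumOfConjugates_comp_of_equivariant _ θ hθ]
      exact hξW ⟨l, rfl⟩
    ext v
    exact LinearMap.congr_fun this v
  apply hξf
  have h0 : w = 0 := by rw [← hgw, h g hdg]; rfl
  have h1 := hw (f.restrictScalars k ∘ₗ θ)
  rw [h0, LinearMap.zero_comp, map_zero] at h1
  rw [← sumOfConjugates_comp_of_equivariant f θ hθ]
  exact h1.symm

end Trace

section

variable {P Q X : Type u} [AddCommGroup P] [Module (MonoidAlgebra k H) P] [AddCommGroup Q]
  [Module (MonoidAlgebra k H) Q] [AddCommGroup X] [Module (MonoidAlgebra k H) X]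
  [Module.Projective (MonoidAlgebra k H) P] [Module.Finite (MonoidAlgebra k H) P]
  [Module.Projective (MonoidAlgebra k H) Q] [Module.Finite (MonoidAlgebra k H) Q]

lemma ExtendsAlong.eq_zero_of_comp_eq_zero {d : P →ₗ[MonoidAlgebra k H] Q}
    (h : ExtendsAlong d X) (g : X →ₗ[MonoidAlgebra k H] P) (hg : d ∘ₗ g = 0) : g = 0 := by
  obtain ⟨_, _⟩ := exists_scalars k (MonoidAlgebra k H) P
  obtain ⟨_, _⟩ := exists_scalars k (MonoidAlgebra k H) Q
  obtain ⟨_, _⟩ := exists_scalars k (MonoidAlgebra k H) X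
  have := finite_scalars k (R := MonoidAlgebra k H) (Y := P)
  have := finite_scalars k (R := MonoidAlgebra k H) (Y := Q)
  exact h.eq_zero_of_scalars g hg

lemma extendsAlong_of_forall_eq_zero [Module.Finite (MonoidAlgebra k H) X]
    {d : P →ₗ[MonoidAlgebra k H] Q}
    (h : ∀ g : X →ₗ[MonoidAlgebra k H] P, d ∘ₗ g = 0 → g = 0) : ExtendsAlong d X := by
  obtain ⟨_, _⟩ := exists_scalars k (MonoidAlgebra k H) P
  obtain ⟨_, _⟩ := exists_scalars k (MonoidAlgebra k H) Q
  obtain ⟨_, _⟩ := exists_scalars k (MonoidAlgebra k H) X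
  have := finite_scalars k (R := MonoidAlgebra k H) (Y := P)
  have := finite_scalars k (R := MonoidAlgebra k H) (Y := Q)
  have := finite_scalars k (R := MonoidAlgebra k H) (Y := X)
  exact extendsAlong_of_eq_zero_of_scalars h

end

end Duality

section TauRigid

lemma IsProjCover.finite {R P M : Type u} [Ring R] [AddCommGroup P] [Module R P] [AddCommGroup M]
    [Module R M] [Module.Finite R M] {π : P →ₗ[R] M} (h : IsProjCover R π) :
    Module.Finite R P := by
  obtain ⟨n, s, hs⟩ := Module.Finite.exists_fin (R := R) (M := M)
  choose t ht using fun i => h.2.1 (s i)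
  classical
  refine ⟨⟨Finset.univ.image t, h.2.2 _ ?_⟩⟩
  rw [← Submodule.comap_map_eq, Submodule.map_span, Finset.coe_image, Set.image_image]
  have : (fun i => π (t i)) = s := funext ht
  rw [Finset.coe_univ, Set.image_univ, this, hs, Submodule.comap_top]

variable {k : Type u} [Field k] {H : Type u} [Group H] [Fintype H]
  {M : Type u} [AddCommGroup M] [Module (MonoidAlgebra k H) M]
  [Module.Finite (MonoidAlgebra k H) M]

lemma IsTauRigid.exists_projPres (h : IsTauRigid (MonoidAlgebra k H) M) :
    ∃ e : ProjPres (MonoidAlgebra k H) M, ExtendsAlong e.d M := by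
  have : IsArtinianRing (MonoidAlgebra k H) := IsArtinianRing.of_finite k _
  obtain ⟨P₀, π₀, hf₀, h₀⟩ := exists_projCover (R := MonoidAlgebra k H) M
  obtain ⟨P₁, π₁, hf₁, h₁⟩ := exists_projCover (R := MonoidAlgebra k H) (LinearMap.ker π₀)
  have := h₀.1
  have := h₁.1
  refine ⟨ProjPres.ofProjCover π₀ h₀ π₁ h₁, ?_⟩
  refine extendsAlong_of_forall_eq_zero (P := P₁) (Q := P₀)
    (d := (LinearMap.ker π₀).subtype ∘ₗ π₁) fun g hg => ?_
  have hg' : ∀ m, π₁ (g m) = 0 := fun m => Subtype.ext (LinearMap.congr_fun hg m)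
  have := h P₀ π₀ h₀ P₁ π₁ h₁ (g.codRestrict _ hg')
  ext m
  exact congrArg Subtype.val (LinearMap.congr_fun this m)

lemma ProjPres.isTauRigid (e : ProjPres (MonoidAlgebra k H) M) (he : ExtendsAlong e.d M) :
    IsTauRigid (MonoidAlgebra k H) M := by
  intro P₀ _ _ π₀ h₀ P₁ _ _ π₁ h₁ g
  have : IsArtinianRing (MonoidAlgebra k H) := IsArtinianRing.of_finite k _
  have := h₀.finite
  have := h₁.finite
  have := h₀.1
  have := h₁.1
  have hd := (ProjPres.ofProjCover_isMin π₀ h₀ π₁ h₁).extendsAlong e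
    ⟨LinearMap.id, LinearMap.id, rfl⟩ he
  have := ExtendsAlong.eq_zero_of_comp_eq_zero (P := P₁) (Q := P₀)
    (d := (LinearMap.ker π₀).subtype ∘ₗ π₁) hd ((LinearMap.ker π₁).subtype ∘ₗ g)
    (LinearMap.ext fun m => congrArg Subtype.val (g m).2)
  ext m
  exact LinearMap.congr_fun this m

end TauRigid

section Induction

variable {R S : Type u} [Ring R] [Ring S] {ι : R →+* S}

lemma exists_restrict (ι : R →+* S) (X : Type u) [AddCommGroup X] [Module S X] :
    ∃ _ : Module R X, ∀ (r : R) (x : X), r • x = ι r • x :=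
  ⟨Module.compHom X ι, fun _ _ => rfl⟩

lemma exists_isInducedMod (ι : R →+* S) (M : Type u) [AddCommGroup M] [Module R M] :
    ∃ (N : ModuleCat.{u} S) (j : M →+ N), IsInducedMod ι M N j := by
  let s : M → (M →₀ S) := fun m => Finsupp.single m 1
  let W : Submodule S (M →₀ S) := Submodule.span S
    ({v | ∃ m m', v = s (m + m') - (s m + s m')} ∪ {v | ∃ r m, v = s (r • m) - ι r • s m})
  let j : M →+ ((M →₀ S) ⧸ W) := AddMonoidHom.mk' (fun m => W.mkQ (s m)) fun m m' => by
    rw [← map_add, ← sub_eq_zero, ← map_sub, Submodule.mkQ_apply, Submodule.Quotient.mk_eq_zero]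
    exact Submodule.subset_span (Or.inl ⟨m, m', rfl⟩)
  refine ⟨ModuleCat.of S ((M →₀ S) ⧸ W), j, fun r m => ?_, fun X _ _ f hf => ?_⟩
  · change W.mkQ (s (r • m)) = ι r • W.mkQ (s m)
    rw [← map_smul, ← sub_eq_zero, ← map_sub, Submodule.mkQ_apply, Submodule.Quotient.mk_eq_zero]
    exact Submodule.subset_span (Or.inr ⟨r, m, rfl⟩)
  · have hs : ∀ m, Finsupp.linearCombination S f (s m) = f m := fun m => by
      simp [s, Finsupp.linearCombination_single]
    have hW : W ≤ LinearMap.ker (Finsupp.linearCombination S f) := by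
      refine Submodule.span_le.mpr ?_
      rintro v (⟨m, m', rfl⟩ | ⟨r, m, rfl⟩)
      · simp [hs]
      · simp [hs, hf]
    have hlift : ∀ m, W.liftQ _ hW (W.mkQ (s m)) = f m := fun m => (W.liftQ_apply _ _).trans (hs m)
    refine ⟨W.liftQ _ hW, hlift, fun g hg => ?_⟩
    · refine Submodule.linearMap_qext _ ?_
      refine Finsupp.lhom_ext' fun m => LinearMap.ext_ring ?_
      exact (hg m).trans (hlift m).symm

namespace IsInducedMod

variable {M N X : Type u} [AddCommGroup M] [Module R M] [AddCommGroup N] [Module S N]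
  [AddCommGroup X] [Module S X] {j : M →+ N}

lemma hom_ext (hN : IsInducedMod ι M N j) {g g' : N →ₗ[S] X}
    (h : ∀ m, g (j m) = g' (j m)) : g = g' := by
  obtain ⟨l, -, hl⟩ := hN.2 X (g'.toAddMonoidHom.comp j) fun r m => by simp [hN.1]
  rw [hl g h, hl g' fun _ => rfl]

lemma exists_lift [Module R X] (hX : ∀ (r : R) (x : X), r • x = ι r • x)
    (hN : IsInducedMod ι M N j) (f : M →ₗ[R] X) : ∃ g : N →ₗ[S] X, ∀ m, g (j m) = f m :=
  (hN.2 X f.toAddMonoidHom fun r m => by simp [hX]).exists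

/-- The restriction of a map out of an induced module. -/
def restrict [Module R X] (hX : ∀ (r : R) (x : X), r • x = ι r • x)
    (hN : IsInducedMod ι M N j) (g : N →ₗ[S] X) : M →ₗ[R] X where
  toFun m := g (j m)
  map_add' _ _ := by rw [map_add, map_add]
  map_smul' _ _ := by rw [hN.1, map_smul, hX, RingHom.id_apply]

lemma span_eq_top (hN : IsInducedMod ι M N j) : Submodule.span S (Set.range j) = ⊤ := by
  have : (Submodule.span S (Set.range j)).mkQ = 0 := hN.hom_ext fun m => by
    rw [LinearMap.zero_apply, Submodule.mkQ_apply, Submodule.Quotient.mk_eq_zero]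
    exact Submodule.subset_span ⟨m, rfl⟩
  rw [← Submodule.ker_mkQ (Submodule.span S (Set.range j)), this, LinearMap.ker_zero]

lemma surjective (hN : IsInducedMod ι M N j) (g : X →ₗ[S] N) (h : ∀ m, ∃ x, g x = j m) :
    Function.Surjective g := by
  rw [← LinearMap.range_eq_top, eq_top_iff, ← hN.span_eq_top, Submodule.span_le]
  rintro _ ⟨m, rfl⟩
  exact h m

lemma finite (hN : IsInducedMod ι M N j) [Module.Finite R M] : Module.Finite S N := by
  obtain ⟨n, s, hs⟩ := Module.Finite.exists_fin (R := R) (M := M)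
  classical
  refine ⟨⟨Finset.univ.image (j ∘ s), ?_⟩⟩
  rw [Finset.coe_image, Finset.coe_univ, Set.image_univ, eq_top_iff, ← hN.span_eq_top,
    Submodule.span_le]
  rintro _ ⟨m, rfl⟩
  have hm : m ∈ Submodule.span R (Set.range s) := hs ▸ Submodule.mem_top
  induction hm using Submodule.span_induction with
  | mem x hx =>
    obtain ⟨i, rfl⟩ := hx
    exact Submodule.subset_span ⟨i, rfl⟩
  | zero => simp
  | add x y _ _ hx hy => rw [map_add]; exact add_mem hx hy
  | smul r x _ hx => rw [hN.1]; exact Submodule.smul_mem _ _ hx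

lemma projective (hN : IsInducedMod ι M N j) [Module.Projective R M] : Module.Projective S N := by
  refine Module.Projective.of_lifting_property'' fun f hf => ?_
  obtain ⟨_, hX⟩ := exists_restrict ι (N →₀ S)
  obtain ⟨_, hY⟩ := exists_restrict ι N
  let f' : (N →₀ S) →ₗ[R] N :=
    { toFun := f
      map_add' := map_add f
      map_smul' := fun r x => by rw [hX, hY, map_smul, RingHom.id_apply] }
  obtain ⟨l, hl⟩ := Module.projective_lifting_property f' (hN.restrict hY LinearMap.id) hf
  obtain ⟨g, hg⟩ := hN.exists_lift hX l
  refine ⟨g, hN.hom_ext fun m => ?_⟩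
  rw [LinearMap.comp_apply, hg]
  exact LinearMap.congr_fun hl m

/-- Induction takes projective presentations to projective presentations. -/
lemma exists_projPres (hN : IsInducedMod ι M N j) (e : ProjPres R M) :
    ∃ c : ProjPres S N, ∀ (X : Type u) [AddCommGroup X] [Module S X] [Module R X],
      (∀ (r : R) (x : X), r • x = ι r • x) → (ExtendsAlong c.d X ↔ ExtendsAlong e.d X) := by
  obtain ⟨I₀, j₀, h₀⟩ := exists_isInducedMod ι e.P₀
  obtain ⟨I₁, j₁, h₁⟩ := exists_isInducedMod ι e.P₁
  have := h₀.finite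
  have := h₁.finite
  have := h₀.projective
  have := h₁.projective
  obtain ⟨_, hI₀⟩ := exists_restrict ι I₀
  obtain ⟨_, hRN⟩ := exists_restrict ι N
  obtain ⟨D, hD⟩ := h₁.exists_lift hI₀ (h₀.restrict hI₀ LinearMap.id ∘ₗ e.d)
  replace hD : ∀ x, D (j₁ x) = j₀ (e.d x) := hD
  obtain ⟨ρ, hρ⟩ := h₀.exists_lift hRN (hN.restrict hRN LinearMap.id ∘ₗ e.π)
  replace hρ : ∀ x, ρ (j₀ x) = j (e.π x) := hρ
  have hρD : ρ ∘ₗ D = 0 := h₁.hom_ext fun m => by simp [hD, hρ, e.π_d]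
  let Z := I₀ ⧸ LinearMap.range D
  obtain ⟨_, hZ⟩ := exists_restrict ι Z
  obtain ⟨q, hq⟩ := e.exists_desc (h₀.restrict hZ (LinearMap.range D).mkQ) fun x => by
    change (LinearMap.range D).mkQ (j₀ (e.d x)) = 0
    rw [← hD, Submodule.mkQ_apply, Submodule.Quotient.mk_eq_zero]
    exact ⟨_, rfl⟩
  obtain ⟨t, ht⟩ := hN.exists_lift hZ q
  have htρ : t ∘ₗ ρ = (LinearMap.range D).mkQ := h₀.hom_ext fun x => by
    rw [LinearMap.comp_apply, hρ, ht, hq]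
    rfl
  refine ⟨{ P₀ := I₀, P₁ := I₁, d := D, π := ρ, exact := fun x => ⟨fun hx => ?_, ?_⟩, surj := ?_ },
    fun X _ _ _ hX => ⟨fun h f => ?_, fun h f => ?_⟩⟩
  · have := LinearMap.congr_fun htρ x
    rw [LinearMap.comp_apply, hx, map_zero] at this
    exact (Submodule.Quotient.mk_eq_zero _).mp this.symm
  · rintro ⟨y, rfl⟩
    exact LinearMap.congr_fun hρD y
  · refine hN.surjective ρ fun m => ?_
    obtain ⟨x, rfl⟩ := e.surj m
    exact ⟨_, hρ x⟩
  · obtain ⟨f', hf'⟩ := h₁.exists_lift hX f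
    obtain ⟨g, hg⟩ := h f'
    refine ⟨h₀.restrict hX g, LinearMap.ext fun x => ?_⟩
    change g (j₀ (e.d x)) = f x
    rw [← hD, ← hf', ← hg]
    rfl
  · obtain ⟨g, hg⟩ := h (h₁.restrict hX f)
    obtain ⟨g', hg'⟩ := h₀.exists_lift hX g
    refine ⟨g', h₁.hom_ext fun x => ?_⟩
    rw [LinearMap.comp_apply, hD, hg']
    exact LinearMap.congr_fun hg x

lemma isGenBy (hN : IsInducedMod ι M N j) [Module R X] (hX : ∀ (r : R) (x : X), r • x = ι r • x)
    (h : IsGenBy R M X) : IsGenBy S N X := by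
  classical
  obtain ⟨r, u, hu⟩ := h
  choose g hg using fun i => hN.exists_lift hX (u ∘ₗ LinearMap.single R (fun _ : Fin r => M) i)
  refine ⟨r, ∑ i, g i ∘ₗ LinearMap.proj i, fun x => ?_⟩
  obtain ⟨m, rfl⟩ := hu x
  refine ⟨fun i => j (m i), ?_⟩
  simp only [LinearMap.sum_apply, LinearMap.comp_apply, LinearMap.proj_apply, hg]
  rw [← map_sum]
  congr 1
  exact LinearMap.sum_single_apply _ m

end IsInducedMod

end Induction

section GroupInduction

open MonoidAlgebra

variable {k : Type u} [Field k] {Gt : Type u} [Group Gt] {G : Subgroup Gt} [G.Normal]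

omit [G.Normal] in
lemma inclRingHom_single (g : G) (c : k) : inclRingHom k Gt G (single g c) = single (g : Gt) c := by
  simp [inclRingHom]

lemma single_mul_inclRingHom_conjRingHom (x : Gt) (r : MonoidAlgebra k G) :
    single x (1 : k) * inclRingHom k Gt G (conjRingHom k Gt G x⁻¹ r) =
      inclRingHom k Gt G r * single x (1 : k) := by
  induction r using MonoidAlgebra.induction_linear with
  | zero => simp
  | add a b ha hb => simp only [map_add, mul_add, add_mul, ha, hb]
  | single g c =>
    have : conjRingHom k Gt G x⁻¹ (single g c) = single (MulAut.conjNormal x⁻¹ g) c := by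
      simp [conjRingHom]
    rw [this, inclRingHom_single, inclRingHom_single, single_mul_single, single_mul_single]
    simp [mul_assoc]

variable {M N X : Type u} [AddCommGroup M] [Module (MonoidAlgebra k G) M]
  [AddCommGroup N] [Module (MonoidAlgebra k Gt) N] [AddCommGroup X] [Module (MonoidAlgebra k Gt) X]
  {j : M →+ N}

/-- The restriction of the module induced from a conjugation stable module `M` is generated by
`M`. -/
lemma IsInducedMod.isGenBy_restrict [Fintype Gt] (hN : IsInducedMod (inclRingHom k Gt G) M N j)
    (hM : ∀ x : Gt, IsConjStable k Gt G x M) [Module (MonoidAlgebra k G) N]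
    (hRN : ∀ (r : MonoidAlgebra k G) (x : N), r • x = inclRingHom k Gt G r • x) :
    IsGenBy (MonoidAlgebra k G) M N := by
  classical
  choose φ hφ using hM
  let h : Gt → M →ₗ[MonoidAlgebra k G] N := fun x =>
    { toFun := fun m => single x (1 : k) • j ((φ x⁻¹).symm m)
      map_add' := fun m m' => by simp
      map_smul' := fun r m => by
        have : (φ x⁻¹).symm (r • m) = conjRingHom k Gt G x⁻¹ r • (φ x⁻¹).symm m := by
          rw [AddEquiv.symm_apply_eq, hφ, AddEquiv.apply_symm_apply]
        rw [this, hN.1, smul_smul, single_mul_inclRingHom_conjRingHom, hRN, mul_smul,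
          RingHom.id_apply] }
  let v : (Gt → M) →ₗ[MonoidAlgebra k G] N := ∑ x, h x ∘ₗ LinearMap.proj x
  have hv : ∀ x m, single x (1 : k) • j m ∈ LinearMap.range v := fun x m => by
    refine ⟨Pi.single x (φ x⁻¹ m), ?_⟩
    have : v (Pi.single x (φ x⁻¹ m)) = ∑ y, h y (Pi.single (M := fun _ => M) x (φ x⁻¹ m) y) := by
      simp [v]
    rw [this, Finset.sum_eq_single x (fun y _ hy => by rw [Pi.single_eq_of_ne hy, map_zero])
      (by simp), Pi.single_eq_same]
    change single x (1 : k) • j ((φ x⁻¹).symm (φ x⁻¹ m)) = _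
    rw [AddEquiv.symm_apply_apply]
  have hv' : ∀ (s : MonoidAlgebra k Gt) (m : M), s • j m ∈ LinearMap.range v := fun s m => by
    induction s using MonoidAlgebra.induction_linear with
    | zero => simp
    | add a b ha hb => rw [add_smul]; exact add_mem ha hb
    | single x c =>
      have : single x c • j m =
          single x (1 : k) • j ((single (1 : G) c : MonoidAlgebra k G) • m) := by
        rw [hN.1, inclRingHom_single, smul_smul, single_mul_single]
        simp
      rw [this]
      exact hv x _
  have hsurj : Function.Surjective v := fun n => by
    have hn : n ∈ Submodule.span (MonoidAlgebra k Gt) (Set.range j) :=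
      hN.span_eq_top ▸ Submodule.mem_top
    change n ∈ LinearMap.range v
    induction hn using Submodule.closure_induction with
    | zero => exact zero_mem _
    | add x y _ _ hx hy => exact add_mem hx hy
    | smul_mem s x hx =>
      obtain ⟨m, rfl⟩ := hx
      exact hv' s m
  refine ⟨Fintype.card Gt, v ∘ₗ LinearMap.funLeft _ M (Fintype.equivFin Gt), ?_⟩
  rw [LinearMap.coe_comp]
  exact hsurj.comp (LinearMap.funLeft_surjective_of_injective _ _ _ (Fintype.equivFin Gt).injective)

omit [G.Normal] in
lemma finite_restrict [Fintype Gt] [Module.Finite (MonoidAlgebra k Gt) X]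
    [Module (MonoidAlgebra k G) X]
    (hX : ∀ (r : MonoidAlgebra k G) (x : X), r • x = inclRingHom k Gt G r • x) :
    Module.Finite (MonoidAlgebra k G) X := by
  obtain ⟨_, _⟩ := exists_scalars k (MonoidAlgebra k Gt) X
  have := finite_scalars k (R := MonoidAlgebra k Gt) (Y := X)
  have : IsScalarTower k (MonoidAlgebra k G) X := ⟨fun c r x => by
    rw [hX, hX, ← smul_assoc]
    congr 1
    induction r using MonoidAlgebra.induction_linear with
    | zero => simp
    | add a b ha hb => simp only [smul_add, map_add, ha, hb]
    | single g a => simp [inclRingHom_single, MonoidAlgebra.smul_single]⟩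
  exact Module.Finite.of_restrictScalars_finite k _ X

end GroupInduction

/-- A projective presentation enlarged by a projective mapping to zero. -/
def ProjPres.addKernel {R M : Type u} [Ring R] [AddCommGroup M] [Module R M] (e : ProjPres R M)
    (P : Type u) [AddCommGroup P] [Module R P]
    [Module.Projective R P] [Module.Finite R P] : ProjPres R M where
  P₀ := e.P₀
  P₁ := e.P₁ × P
  d := e.d ∘ₗ LinearMap.fst R e.P₁ P
  π := e.π
  exact x := (e.exact x).trans ⟨fun ⟨y, hy⟩ => ⟨(y, 0), hy⟩, fun ⟨y, hy⟩ => ⟨y.1, hy⟩⟩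
  surj := e.surj

/-- If `M` is a support τ-tilting `kG`-module with `x M ≅ M`
for all `x ∈ G̃`, then `Ind_G^{G̃} M` is a support τ-tilting `kG̃`-module. -/
theorem isSupportTauTilting_induced
    (k : Type u) [Field k] [IsAlgClosed k] (p : ℕ) (hp : 0 < p) [CharP k p]
    (Gt : Type u) [Group Gt] [Fintype Gt] (G : Subgroup Gt) [G.Normal]
    (M : Type u) [AddCommGroup M] [Module (MonoidAlgebra k ↥G) M]
    [Module.Finite (MonoidAlgebra k ↥G) M]
    (hst : IsSupportTauTilting (MonoidAlgebra k ↥G) M)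
    (hM : ∀ x : Gt, IsConjStable k Gt G x M)
    (N : Type u) [AddCommGroup N] [Module (MonoidAlgebra k Gt) N]
    (jM : M →+ N) (hN : IsInducedMod (inclRingHom k Gt G) M N jM) :
    IsSupportTauTilting (MonoidAlgebra k Gt) N := by
  classical
  have := Fintype.ofFinite G
  obtain ⟨hrig, P, hPproj, hPfin, hPM, hcard⟩ := hst
  obtain ⟨e, he⟩ := hrig.exists_projPres
  obtain ⟨c, hc⟩ := hN.exists_projPres (e.addKernel P)
  have := hN.finite
  have hd : ∀ (X : Type u) [AddCommGroup X] [Module (MonoidAlgebra k G) X],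
      ExtendsAlong (e.addKernel P).d X ↔
        ExtendsAlong e.d X ∧ ∀ f : P →ₗ[MonoidAlgebra k G] X, f = 0 :=
    fun X _ _ => extendsAlong_comp_fst_iff e.d
  have hcN : ExtendsAlong c.d N := by
    obtain ⟨_, hRN⟩ := exists_restrict (inclRingHom k Gt G) N
    have hgen := hN.isGenBy_restrict hM hRN
    exact (hc N hRN).mpr ((hd N).mpr ⟨he.of_isGenBy hgen, hom_eq_zero_of_isGenBy hPM hgen⟩)
  refine ⟨c.isTauRigid hcN, exists_support_of_gen k c hcN fun X _ _ _ hX => ?_⟩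
  obtain ⟨_, hRX⟩ := exists_restrict (inclRingHom k Gt G) X
  have := finite_restrict hRX
  obtain ⟨hX₁, hX₂⟩ := (hd X).mp ((hc X hRX).mp hX)
  exact hN.isGenBy hRX (isGenBy_of_extendsAlong k e he hPM hcard hX₁ hX₂)
end

section
/- Let k be an algebraically closed field of characteristic p > 0, let G be a normal subgroup of a finite group G̃, let B be a block of kG and B̃ a block of kG̃ covering B. If M and M' are I_{G̃}(B)-invariant support τ-tilting B-modules with M ≥ M' in the partial order on support τ-tilting B-modules, then B̃·Ind_G^{G̃} M ≥ B̃·Ind_G^{G̃} M' in the partial order on support τ-tilting B̃-modules. -/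
/-!
Common definitions: τ-tilting theory over a ring, blocks of group algebras,
conjugate modules and induced modules.

Since group algebras (and their blocks) are symmetric algebras, the
Auslander–Reiten translate is `τ = Ω²` computed via (minimal) projective covers;
τ-rigidity is formulated accordingly.  Support τ-tilting modules are formulated
via support τ-tilting pairs: `M` is support τ-tilting iff `M` is τ-rigid and
there is a projective module `P` with `Hom(P, M) = 0` and `|M| + |P| = |Λ|`
(the number of simple modules), which is the standard equivalent
characterisation (Adachi–Iyama–Reiten, Prop. 2.3; Remark 2.2 of the paper).
-/

universe u

/-- An induced module is generated by the image of the structure map. -/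
theorem IsInducedMod.span_range_eq_top {R S : Type u} [Ring R] [Ring S] {ι : R →+* S}
    {M : Type u} [AddCommGroup M] [Module R M] {N : Type u} [AddCommGroup N] [Module S N]
    {j : M →+ N} (h : IsInducedMod ι M N j) : Submodule.span S (Set.range j) = ⊤ := by
  obtain ⟨g, -, hg⟩ := h.2 (N ⧸ Submodule.span S (Set.range j)) 0 (by simp)
  have hmk : (Submodule.span S (Set.range j)).mkQ = 0 := by
    rw [hg 0 (by simp)]
    refine hg _ fun m => ?_
    simpa using Submodule.subset_span (Set.mem_range_self m)
  rw [← Submodule.ker_mkQ (Submodule.span S (Set.range j)), hmk, LinearMap.ker_zero]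

/-- Induction of modules preserves the relation `stGE`. -/
theorem stGE.induced {R S : Type u} [Ring R] [Ring S] {ι : R →+* S}
    {M M' N N' : Type u} [AddCommGroup M] [Module R M] [AddCommGroup M'] [Module R M']
    [AddCommGroup N] [Module S N] [AddCommGroup N'] [Module S N'] {j : M →+ N} {j' : M' →+ N'}
    (hN : IsInducedMod ι M N j) (hN' : IsInducedMod ι M' N' j') (h : stGE R M M') :
    stGE S N N' := by
  obtain ⟨r, hr, φ, hφ⟩ := h
  have key (i : Fin r) : ∃ g : N →ₗ[S] N', ∀ m, g (j m) = j' (φ (Pi.single i m)) := by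
    obtain ⟨g, hg, -⟩ := hN.2 N'
      (j'.comp (φ.comp (LinearMap.single R (fun _ : Fin r => M) i)).toAddMonoidHom)
      (fun a m => by
        change j' ((φ ∘ₗ LinearMap.single R (fun _ : Fin r => M) i) (a • m)) = _
        rw [map_smul, hN'.1]
        rfl)
    exact ⟨g, hg⟩
  choose g hg using key
  refine ⟨r, hr, ∑ i, g i ∘ₗ LinearMap.proj i, ?_⟩
  rw [← LinearMap.range_eq_top, eq_top_iff, ← hN'.span_range_eq_top, Submodule.span_le]
  rintro _ ⟨m', rfl⟩
  obtain ⟨v, rfl⟩ := hφ m'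
  refine ⟨fun i => j (v i), ?_⟩
  simp only [LinearMap.sum_apply, LinearMap.comp_apply, LinearMap.proj_apply, hg]
  rw [← map_sum, ← map_sum, Finset.univ_sum_single]

/-- Passing to the component at a central idempotent preserves the relation `stGE`. -/
theorem stGE.blockComponent {A : Type u} [Ring A] {b : A} (hbb : b * b = b)
    (hb : ∀ r : A, b * r = r * b) {N N' : Type u} [AddCommGroup N] [Module A N]
    [AddCommGroup N'] [Module A N'] (h : stGE A N N') :
    stGE A ↥(_root_.blockComponent A b hb N) ↥(_root_.blockComponent A b hb N') := by
  obtain ⟨r, hr, φ, hφ⟩ := h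
  let ψ : (Fin r → ↥(_root_.blockComponent A b hb N)) →ₗ[A] (Fin r → N) :=
    LinearMap.pi fun i => (_root_.blockComponent A b hb N).subtype ∘ₗ LinearMap.proj i
  have hψ (v) : b • ψ v = ψ v := funext fun i => (v i).2
  refine ⟨r, hr, (φ ∘ₗ ψ).codRestrict _ fun v => ?_, fun n => ?_⟩
  · change b • φ (ψ v) = φ (ψ v)
    rw [← map_smul, hψ]
  · obtain ⟨v, hv⟩ := hφ n
    refine ⟨fun i => ⟨b • v i, ?_⟩, Subtype.ext ?_⟩
    · change b • b • v i = b • v i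
      rw [← mul_smul, hbb]
    · change φ (b • v) = n
      rw [map_smul, hv]
      exact n.2

/-- If `M ≥ M'` for `I_{G̃}(B)`-invariant support τ-tilting
`B`-modules `M, M'`, then `B̃ · Ind M ≥ B̃ · Ind M'` for the covering block
`B̃`. -/
theorem stGE_blockComponent_induced_of_stGE
    (k : Type u) [Field k] [IsAlgClosed k] (p : ℕ) (hp : 0 < p) [CharP k p]
    (Gt : Type u) [Group Gt] [Fintype Gt] (G : Subgroup Gt) [G.Normal]
    (b : MonoidAlgebra k ↥G) (hb : IsBlockIdem (MonoidAlgebra k ↥G) b)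
    (bt : MonoidAlgebra k Gt) (hbt : IsBlockIdem (MonoidAlgebra k Gt) bt)
    (hcover : inclRingHom k Gt G b * bt ≠ 0)
    (M : Type u) [AddCommGroup M] [Module (MonoidAlgebra k ↥G) M]
    [Module.Finite (MonoidAlgebra k ↥G) M]
    (M' : Type u) [AddCommGroup M'] [Module (MonoidAlgebra k ↥G) M']
    [Module.Finite (MonoidAlgebra k ↥G) M']
    (hst : IsSupportTauTiltingBlock (MonoidAlgebra k ↥G) b M)
    (hst' : IsSupportTauTiltingBlock (MonoidAlgebra k ↥G) b M')
    (hinv : ∀ x : Gt, conjRingHom k Gt G x b = b → IsConjStable k Gt G x M)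
    (hinv' : ∀ x : Gt, conjRingHom k Gt G x b = b → IsConjStable k Gt G x M')
    (hord : stGE (MonoidAlgebra k ↥G) M M')
    (N : Type u) [AddCommGroup N] [Module (MonoidAlgebra k Gt) N]
    (jM : M →+ N) (hN : IsInducedMod (inclRingHom k Gt G) M N jM)
    (N' : Type u) [AddCommGroup N'] [Module (MonoidAlgebra k Gt) N']
    (jM' : M' →+ N') (hN' : IsInducedMod (inclRingHom k Gt G) M' N' jM') :
    stGE (MonoidAlgebra k Gt)
      ↥(blockComponent (MonoidAlgebra k Gt) bt hbt.2.2.1 N)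
      ↥(blockComponent (MonoidAlgebra k Gt) bt hbt.2.2.1 N') := by
  exact (hord.induced hN hN').blockComponent hbt.2.1 hbt.2.2.1
end
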